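/- For F in the Schwartz space on ℝ³ = ℝ²_x × ℝ_z, the norm ‖F‖_{Σ₀^s} defined via Littlewood–Paley projections P_N (localizing simultaneously the 2D harmonic oscillator H₀ to λ ∼ N² and the z-frequency to |ζ| ∼ N) by ‖F‖²_{Σ₀^s} = Σ_{N ∈ 2^ℕ} N^{2s} ‖P_N F‖²_{L²(ℝ³)}, is equivalent to (‖F‖²_{H^s(ℝ³)} + ‖|x|^s F‖²_{L²(ℝ³)})^{1/2}. -/

import Mathlib

open MeasureTheory Complex
open scoped ENNReal NNReal

noncomputable section

/-- The `n`-th (probabilists') Hermite polynomial, evaluated over ℝ. -/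
def hermitePolyR (n : ℕ) (x : ℝ) : ℝ := Polynomial.aeval x (Polynomial.hermite n)

/-- The `n`-th normalized eigenfunction of the 1D oscillator `-(1/2)∂² + (1/8)x²`. -/
def hermiteFn (n : ℕ) (x : ℝ) : ℝ :=
  hermitePolyR n x * Real.exp (-x ^ 2 / 4) /
    Real.sqrt (Real.sqrt (2 * Real.pi) * (n.factorial : ℝ))

/-- Product eigenfunctions of the 2D harmonic oscillator `H₀ = -(1/2)Δ + (1/8)|x|²`,
with `H₀ h_{n₁,n₂} = ((n₁+n₂+1)/2) h_{n₁,n₂}`. -/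
def herm2 (m : ℕ × ℕ) (x : ℝ × ℝ) : ℝ := hermiteFn m.1 x.1 * hermiteFn m.2 x.2

/-- Partial Fourier transform in the `z` variable. -/
def FTz (F : (ℝ × ℝ) × ℝ → ℂ) (x : ℝ × ℝ) (ζ : ℝ) : ℂ :=
  ∫ z : ℝ, Complex.exp (-(Complex.I) * z * ζ) * F (x, z)

/-- Hermite coefficient of a function on `ℝ²_x`. -/
def coefH (m : ℕ × ℕ) (G : ℝ × ℝ → ℂ) : ℂ := ∫ x : ℝ × ℝ, (herm2 m x : ℂ) * G x

/-- The Littlewood–Paley projection `P_{≤N}`, localizing simultaneously the harmonic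
oscillator `H₀` to `λ ≲ N²` (via `φ(H₀/N²)`) and the `z`-frequency to `|ζ| ≲ N`
(via `φ(ζ/N)`). -/
def PleN (φ : ℝ → ℝ) (N : ℝ) (F : (ℝ × ℝ) × ℝ → ℂ) : (ℝ × ℝ) × ℝ → ℂ :=
  fun p => ((1 / (2 * Real.pi) : ℝ) : ℂ) *
    ∫ ζ : ℝ, Complex.exp (Complex.I * p.2 * ζ) * ((φ (ζ / N) : ℝ) : ℂ) *
      ∑' m : ℕ × ℕ,
        ((φ ((((m.1 : ℝ) + (m.2 : ℝ)) + 1) / 2 / N ^ 2) : ℝ) : ℂ) *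
          coefH m (fun x => FTz F x ζ) * ((herm2 m p.1 : ℝ) : ℂ)

/-- The Littlewood–Paley piece `P_N = P_{≤N} - P_{≤N/2}`. -/
def PLP (φ : ℝ → ℝ) (N : ℝ) (F : (ℝ × ℝ) × ℝ → ℂ) : (ℝ × ℝ) × ℝ → ℂ :=
  fun p => PleN φ N F p - PleN φ (N / 2) F p

/-- The norm `‖F‖_{Σ₀^s} = (Σ_{N ∈ 2^ℕ} N^{2s} ‖P_N F‖²_{L²})^{1/2}`. -/
def Sig0Norm (s : ℝ) (φ : ℝ → ℝ) (F : (ℝ × ℝ) × ℝ → ℂ) : ℝ≥0∞ :=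
  (∑' k : ℕ, ENNReal.ofReal ((2 : ℝ) ^ (2 * s * (k : ℝ))) *
      (eLpNorm (PLP φ ((2 : ℝ) ^ (k : ℕ)) F) 2 volume) ^ 2) ^ ((1 : ℝ) / 2)

/-- Fourier transform on `ℝ³ = ℝ²_x × ℝ_z`. -/
def FT3 (F : (ℝ × ℝ) × ℝ → ℂ) (ξ : (ℝ × ℝ) × ℝ) : ℂ :=
  ∫ p : (ℝ × ℝ) × ℝ,
    Complex.exp (-(Complex.I) * (p.1.1 * ξ.1.1 + p.1.2 * ξ.1.2 + p.2 * ξ.2)) * F p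

/-- The Sobolev `H^s(ℝ³)` norm, computed on the Fourier side. -/
def SobNorm (s : ℝ) (F : (ℝ × ℝ) × ℝ → ℂ) : ℝ≥0∞ :=
  (∫⁻ ξ : (ℝ × ℝ) × ℝ,
      ENNReal.ofReal ((1 + ξ.1.1 ^ 2 + ξ.1.2 ^ 2 + ξ.2 ^ 2) ^ s) *
        (‖FT3 F ξ‖₊ : ℝ≥0∞) ^ 2) ^ ((1 : ℝ) / 2)

/-- The weighted norm `‖|x|^s F‖_{L²(ℝ³)}`. -/
def WtNorm (s : ℝ) (F : (ℝ × ℝ) × ℝ → ℂ) : ℝ≥0∞ :=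
  eLpNorm (fun p : (ℝ × ℝ) × ℝ => (((p.1.1 ^ 2 + p.1.2 ^ 2) ^ (s / 2) : ℝ) : ℂ) * F p) 2 volume

section

open FourierTransform SchwartzMap in
lemma fourier_L1_L2_norm (f : ℝ → ℂ) (hf1 : Integrable f) (hf2 : MemLp f 2) :
    eLpNorm (𝓕 f) 2 = eLpNorm f 2 := by
  set g : Lp ℂ 2 (volume : Measure ℝ) := 𝓕 (hf2.toLp f) with hg
  have hae : ∀ᵐ x, 𝓕 f x = g x := by
    apply ae_eq_of_integral_contDiff_smul_eq
    · exact (Continuous.locallyIntegrable (by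
        exact VectorFourier.fourierIntegral_continuous Real.continuous_fourierChar
          (by exact continuous_inner) hf1))
    · exact (Lp.memLp g).locallyIntegrable (by norm_num)
    · intro u hu hus
      have hu' : ContDiff ℝ (⊤ : ℕ∞) (fun x => (u x : ℂ)) := by
        exact Complex.ofRealCLM.contDiff.comp hu
      have hus' : HasCompactSupport (fun x => (u x : ℂ)) := by
        exact hus.comp_left (g := fun x : ℝ => (x : ℂ)) rfl
      set U : 𝓢(ℝ, ℂ) := hus'.toSchwartzMap hu' with hU
      have hUx : ∀ x, U x = (u x : ℂ) := fun x => rfl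
      have h1 := DFunLike.congr_fun (Lp.fourier_toTemperedDistribution_eq (hf2.toLp f)) U
      rw [← hg] at h1
      rw [TemperedDistribution.fourier_apply, Lp.toTemperedDistribution_apply,
        Lp.toTemperedDistribution_apply] at h1
      have h2 : ∫ x, (𝓕 U) x • (hf2.toLp f) x = ∫ x, (𝓕 U) x • f x := by
        apply integral_congr_ae
        filter_upwards [hf2.coeFn_toLp] with x hx
        rw [hx]
      have h3 := VectorFourier.integral_fourierIntegral_smul_eq_flip
        (L := innerₗ ℝ) (μ := (volume : Measure ℝ)) (ν := (volume : Measure ℝ)) (f := U) (g := f)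
        (e := Real.fourierChar)
        Real.continuous_fourierChar (by exact continuous_inner) U.integrable hf1
      calc ∫ x, u x • 𝓕 f x = ∫ x, U x • 𝓕 f x := by
            apply integral_congr_ae; filter_upwards with x; rw [hUx]; simp
        _ = ∫ x, (𝓕 U) x • f x := by
            rw [flip_innerₗ] at h3
            rw [fourier_coe]
            exact h3.symm
        _ = ∫ x, U x • g x := by rw [← h2, h1]
        _ = _ := by
            apply integral_congr_ae; filter_upwards with x; rw [hUx]; simp
  rw [eLpNorm_congr_ae hae, ← eLpNorm_congr_ae hf2.coeFn_toLp]
  have := Lp.norm_fourier_eq (hf2.toLp f)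
  rw [← hg, Lp.norm_def, Lp.norm_def] at this
  exact (ENNReal.toReal_eq_toReal_iff' (Lp.eLpNorm_ne_top _) (Lp.eLpNorm_ne_top _)).1 this

/-- Continuous functions with quadratic decay. -/
def Dec (f : ℝ → ℂ) : Prop := Continuous f ∧ ∃ C : ℝ, ∀ x, ‖f x‖ ≤ C / (1 + x ^ 2)

/-- 1D Fourier transform. -/
def ft (f : ℝ → ℂ) (ξ : ℝ) : ℂ := ∫ x : ℝ, Complex.exp (-(Complex.I) * x * ξ) * f x

lemma integrable_dec : Integrable (fun x : ℝ => 1 / (1 + x ^ 2)) := by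
  simpa using integrable_inv_one_add_sq

lemma Dec.integrable {f : ℝ → ℂ} (hf : Dec f) : Integrable f := by
  obtain ⟨hc, C, hC⟩ := hf
  refine (integrable_dec.const_mul C).mono' hc.aestronglyMeasurable ?_
  filter_upwards with x
  simpa [div_eq_mul_inv] using hC x

lemma Dec.memLp {f : ℝ → ℂ} (hf : Dec f) : MemLp f 2 := by
  have hi := hf.integrable
  obtain ⟨hc, C, hC⟩ := hf
  have hC0 : 0 ≤ C := by simpa using (norm_nonneg _).trans (hC 0)
  refine (memLp_two_iff_integrable_sq_norm hc.aestronglyMeasurable).2 ?_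
  refine (hi.norm.const_mul C).mono' (by fun_prop) ?_
  filter_upwards with x
  have h : ‖f x‖ ≤ C := (hC x).trans (div_le_self hC0 (by nlinarith [sq_nonneg x]))
  rw [Real.norm_of_nonneg (by positivity)]
  nlinarith [norm_nonneg (f x)]

lemma eLpNorm_two_sq {α : Type*} [MeasurableSpace α] (μ : Measure α) (f : α → ℂ) :
    eLpNorm f 2 μ ^ 2 = ∫⁻ x, ‖f x‖ₑ ^ 2 ∂μ := by
  rw [eLpNorm_eq_lintegral_rpow_enorm_toReal (by norm_num) (by norm_num)]
  rw [← ENNReal.rpow_natCast, ← ENNReal.rpow_mul]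
  simp

lemma lintegral_scale (f : ℝ → ℝ≥0∞) {c : ℝ} (hc : 0 < c) :
    ∫⁻ x, f x = ENNReal.ofReal c * ∫⁻ x, f (c * x) := by
  conv_lhs => rw [← Real.smul_map_volume_mul_left hc.ne']
  rw [lintegral_smul_measure, abs_of_pos hc, smul_eq_mul]
  congr 1
  exact (Homeomorph.mulLeft₀ c hc.ne').measurableEmbedding.lintegral_map f

open FourierTransform in
lemma plancherel {f : ℝ → ℂ} (hf : Dec f) :
    ∫⁻ ξ, ‖ft f ξ‖ₑ ^ 2 = ENNReal.ofReal (2 * Real.pi) * ∫⁻ x, ‖f x‖ₑ ^ 2 := by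
  have h := fourier_L1_L2_norm f hf.integrable hf.memLp
  have h2 : ∫⁻ ξ, ‖(𝓕 f) ξ‖ₑ ^ 2 = ∫⁻ x, ‖f x‖ₑ ^ 2 := by
    rw [← eLpNorm_two_sq, ← eLpNorm_two_sq, h]
  rw [lintegral_scale _ (c := 2 * Real.pi) (by positivity), ← h2]
  congr 1
  apply lintegral_congr
  intro ξ
  congr 2
  rw [Real.fourier_eq', ft]
  congr 1
  ext x
  simp
  left
  congr 1
  ring

end

section

open Polynomial in
lemma integrable_poly_gauss (p : ℝ[X]) {c : ℝ} (hc : 0 < c) :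
    Integrable (fun x : ℝ => p.eval x * Real.exp (-c * x ^ 2)) := by
  induction p using Polynomial.induction_on' with
  | add p q hp hq => 
    simp only [eval_add, add_mul]; exact hp.add hq
  | monomial n a => 
    simp only [eval_monomial, mul_assoc]
    refine Integrable.const_mul ?_ a
    have := integrable_rpow_mul_exp_neg_mul_sq hc (s := (n : ℝ)) 
      (by have : (0:ℝ) ≤ n := n.cast_nonneg
          linarith)
    simpa using this

open Polynomial in
lemma derivative_hermite_succ (n : ℕ) :
    derivative (hermite (n + 1)) = ((n : ℤ[X]) + 1) * hermite n := by
  induction n with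
  | zero => simp
  | succ n ih => 
    rw [hermite_succ (n + 1), derivative_sub, derivative_mul, ih, hermite_succ n]
    simp only [derivative_mul, derivative_add, derivative_natCast, derivative_one, derivative_X]
    push_cast
    ring

open Polynomial in
/-- Real Hermite polynomials. -/
def HR (n : ℕ) : ℝ[X] := (hermite n).map (Int.castRingHom ℝ)

open Polynomial

lemma HR_eval (n : ℕ) (x : ℝ) : (HR n).eval x = hermitePolyR n x := by
  simp [HR, hermitePolyR, Polynomial.aeval_def, Polynomial.eval_map]

lemma HR_succ (n : ℕ) : HR (n + 1) = X * HR n - derivative (HR n) := by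
  simp [HR, hermite_succ]

lemma HR_deriv (n : ℕ) : derivative (HR (n + 1)) = C ((n : ℝ) + 1) * HR n := by
  rw [HR, derivative_map, derivative_hermite_succ]
  simp [HR]

lemma HR_zero : HR 0 = 1 := by simp [HR]

/-- Gaussian pairing. -/
def JJ (p q : ℝ[X]) : ℝ := ∫ x : ℝ, p.eval x * q.eval x * Real.exp (-(1/2) * x ^ 2)

lemma JJ_ibp (p q : ℝ[X]) : JJ (X * p - derivative p) q = JJ p (derivative q) := by
  have key := integral_mul_deriv_eq_deriv_mul_of_integrable (A := ℝ)
    (u := fun x => q.eval x) (u' := fun x => (derivative q).eval x)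
    (v := fun x => p.eval x * Real.exp (-(1/2) * x ^ 2))
    (v' := fun x => (derivative p - X * p).eval x * Real.exp (-(1/2) * x ^ 2))
    (fun x _ => q.hasDerivAt x)
    (fun x _ => by
      have h1 := p.hasDerivAt x
      have h2 : HasDerivAt (fun x : ℝ => Real.exp (-(1/2) * x ^ 2))
          (Real.exp (-(1/2) * x ^ 2) * (-(1/2) * (2 * x))) x := by
        have := ((hasDerivAt_pow 2 x).const_mul (-(1/2) : ℝ)).exp
        simpa using this
      convert! h1.mul h2 using 1
      simp; ring)
    (by
      convert integrable_poly_gauss (q * (derivative p - X * p)) (c := 1/2) (by norm_num) using 2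
      simp; ring)
    (by
      convert integrable_poly_gauss (derivative q * p) (c := 1/2) (by norm_num) using 2
      simp; ring)
    (by
      convert integrable_poly_gauss (q * p) (c := 1/2) (by norm_num) using 2
      simp; ring)
  unfold JJ
  rw [← neg_inj, ← integral_neg]
  calc _ = ∫ x, eval x q * (eval x (derivative p - X * p) * Real.exp (-(1 / 2) * x ^ 2)) := by
        congr 1; ext x; simp; ring
    _ = _ := key
    _ = _ := by
        congr 2; ext x; ring

lemma JJ_symm (p q : ℝ[X]) : JJ p q = JJ q p := by
  unfold JJ; congr 1; ext x; ring

lemma JJ_C_mul (p q : ℝ[X]) (a : ℝ) : JJ p (C a * q) = a * JJ p q := by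
  unfold JJ; rw [← integral_const_mul]; congr 1; ext x; simp; ring

lemma JJ_HR (n m : ℕ) :
    JJ (HR n) (HR m) = if n = m then Real.sqrt (2 * Real.pi) * (n.factorial : ℝ) else 0 := by
  have hz : ∀ n, JJ (HR (n + 1)) (HR 0) = 0 := by
    intro n
    rw [HR_succ, JJ_ibp, HR_zero]
    simp [JJ]
  induction n generalizing m with
  | zero =>
    cases m with
    | zero => 
      have := integral_gaussian (1/2)
      simp only [JJ, HR_zero, eval_one, one_mul, this]
      simp [mul_comm]
    | succ m => rw [JJ_symm, hz]; simp
  | succ n ih =>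
    cases m with
    | zero => rw [hz]; simp
    | succ m =>
      rw [HR_succ, JJ_ibp, HR_deriv, JJ_C_mul, ih]
      by_cases h : n = m
      · subst h; simp [Nat.factorial_succ]; ring
      · simp [h]

lemma hermiteFn_eq (n : ℕ) (x : ℝ) : hermiteFn n x = 
    (HR n).eval x * Real.exp (-(1/4) * x ^ 2) / 
      Real.sqrt (Real.sqrt (2 * Real.pi) * (n.factorial : ℝ)) := by
  rw [hermiteFn, HR_eval]; congr 3; ring

lemma hermiteFn_continuous (n : ℕ) : Continuous (hermiteFn n) := by
  have : hermiteFn n = _ := funext (hermiteFn_eq n)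
  rw [this]; fun_prop

lemma hermiteFn_integrable (n : ℕ) : Integrable (hermiteFn n) := by
  have : hermiteFn n = _ := funext (hermiteFn_eq n)
  rw [this]
  exact (integrable_poly_gauss _ (by norm_num)).div_const _

lemma hermiteFn_mul (n m : ℕ) (x : ℝ) : hermiteFn n x * hermiteFn m x = 
    ((HR n).eval x * (HR m).eval x * Real.exp (-(1/2) * x ^ 2)) / 
      (Real.sqrt (Real.sqrt (2 * Real.pi) * (n.factorial : ℝ)) *
      Real.sqrt (Real.sqrt (2 * Real.pi) * (m.factorial : ℝ))) := by
  rw [hermiteFn_eq, hermiteFn_eq, div_mul_div_comm]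
  congr 1
  rw [show (-(1/2) * x ^ 2) = (-(1/4) * x ^ 2) + (-(1/4) * x ^ 2) by ring, Real.exp_add]
  ring

lemma hermiteFn_mul_integrable (n m : ℕ) : 
    Integrable (fun x => hermiteFn n x * hermiteFn m x) := by
  simp_rw [hermiteFn_mul]
  refine Integrable.div_const ?_ _
  convert integrable_poly_gauss (HR n * HR m) (c := 1/2) (by norm_num) using 2
  simp

lemma hermiteFn_orthonormal (n m : ℕ) :
    ∫ x, hermiteFn n x * hermiteFn m x = if n = m then 1 else 0 := by
  simp_rw [hermiteFn_mul]
  rw [integral_div]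
  have := JJ_HR n m
  rw [JJ] at this
  rw [this]
  split_ifs with h
  · subst h
    rw [Real.mul_self_sqrt (by positivity), div_self (by positivity)]
  · simp

/-- Complexified generating function. -/
lemma hermite_iteratedDeriv (x : ℂ) (n : ℕ) :
    iteratedDeriv n (fun w : ℂ => Complex.exp (x * w - w ^ 2 / 2)) = 
      fun w => (aeval (x - w) (hermite n)) * Complex.exp (x * w - w ^ 2 / 2) := by
  induction n with
  | zero => ext w; simp
  | succ n ih =>
    rw [iteratedDeriv_succ, ih]
    ext w
    have h1 : HasDerivAt (fun w : ℂ => aeval (x - w) (hermite n))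
        (aeval (x - w) (derivative (hermite n)) * (-1)) w := by
      have a := (hermite n).hasDerivAt_aeval (x - w)
      have b : HasDerivAt (fun w : ℂ => x - w) (-1) w := by
        simpa using (hasDerivAt_id w).const_sub x
      exact a.comp w b
    have h2 : HasDerivAt (fun w : ℂ => Complex.exp (x * w - w ^ 2 / 2))
        (Complex.exp (x * w - w ^ 2 / 2) * (x - w)) w := by
      have : HasDerivAt (fun w : ℂ => x * w - w ^ 2 / 2) (x - w) w := by
        have a := (hasDerivAt_id w).const_mul x
        have b := (hasDerivAt_pow 2 w).div_const 2
        convert! a.sub b using 1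
        simp
      exact this.cexp
    refine (h1.mul h2).deriv.trans ?_
    rw [hermite_succ]
    simp
    ring

/-- Coherent state kernel. -/
def KK (x : ℝ) (w : ℂ) : ℂ := (Real.sqrt (Real.sqrt (2 * Real.pi)) : ℂ)⁻¹ * 
  Complex.exp (-x ^ 2 / 4 + x * w - w ^ 2 / 2)

lemma KK_hasSum (x : ℝ) (w : ℂ) :
    HasSum (fun n : ℕ => (hermiteFn n x : ℂ) * (w ^ n / (Real.sqrt n.factorial : ℂ))) (KK x w) := by
  have h := Complex.hasSum_taylorSeries_of_entire
    (f := fun w : ℂ => Complex.exp ((x : ℂ) * w - w ^ 2 / 2)) (by fun_prop) 0 w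
  have h' := h.mul_left ((Real.sqrt (Real.sqrt (2 * Real.pi)) : ℂ)⁻¹ * Complex.exp (-x ^ 2 / 4))
  convert! h' using 1
  · ext n
    rw [hermite_iteratedDeriv]
    simp only [hermiteFn, hermitePolyR]
    rw [Real.sqrt_mul (by positivity)]
    have e1 : (aeval ((x : ℂ) - 0)) (hermite n) = ((aeval x (hermite n) : ℝ) : ℂ) := by
      rw [sub_zero]
      exact (Polynomial.aeval_algebraMap_apply ℂ x (hermite n))
    have e2 : (n.factorial : ℂ) = (Real.sqrt n.factorial : ℂ) * (Real.sqrt n.factorial : ℂ) := by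
      rw [← Complex.ofReal_mul, Real.mul_self_sqrt (by positivity)]; simp
    rw [e1, e2]
    simp
    field_simp
  · rw [KK, mul_assoc, ← Complex.exp_add]; congr 2; ring

/-- Hermite coefficients in 1D. -/
def coef1 (n : ℕ) (f : ℝ → ℂ) : ℂ := ∫ x : ℝ, (hermiteFn n x : ℂ) * f x

/-- Bargmann transform. -/
def BB (f : ℝ → ℂ) (w : ℂ) : ℂ := ∫ x : ℝ, KK x w * f x

lemma hermiteFn_memLp (n : ℕ) : MemLp (fun x => (hermiteFn n x : ℂ)) 2 := by
  refine (memLp_two_iff_integrable_sq_norm ?_).2 ?_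
  · exact (Complex.continuous_ofReal.comp (hermiteFn_continuous n)).aestronglyMeasurable
  · simpa [sq] using hermiteFn_mul_integrable n n

lemma hermiteFn_mul_dec_integrable (n : ℕ) {f : ℝ → ℂ} (hf : Dec f) : 
    Integrable (fun x => (hermiteFn n x : ℂ) * f x) :=
  (hermiteFn_memLp n).integrable_mul hf.memLp

lemma coef1_norm_bound {f : ℝ → ℂ} (hf : Dec f) : ∃ M : ℝ, ∀ n,
    ∫ x : ℝ, ‖(hermiteFn n x : ℂ) * f x‖ ≤ M := by
  refine ⟨(1 + ∫ x, ‖f x‖ ^ 2), fun n => ?_⟩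
  have h1 : ∫ x, hermiteFn n x ^ 2 = 1 := by simpa [sq] using hermiteFn_orthonormal n n
  have i1 : Integrable (fun x => hermiteFn n x ^ 2) := by
    simpa [sq] using hermiteFn_mul_integrable n n
  have i2 : Integrable (fun x => ‖f x‖ ^ 2) := 
    (memLp_two_iff_integrable_sq_norm hf.1.aestronglyMeasurable).1 hf.memLp
  rw [← h1, ← integral_add i1 i2]
  apply integral_mono (hermiteFn_mul_dec_integrable n hf).norm (i1.add i2)
  intro x
  simp only [norm_mul, Complex.norm_real, Real.norm_eq_abs]
  change |hermiteFn n x| * ‖f x‖ ≤ hermiteFn n x ^ 2 + ‖f x‖ ^ 2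
  rw [← sq_abs (hermiteFn n x)]
  nlinarith [sq_nonneg (|hermiteFn n x| - ‖f x‖), abs_nonneg (hermiteFn n x), norm_nonneg (f x)]

lemma summable_pow_div_sqrt_factorial (r : ℝ) (hr : 0 ≤ r) : 
    Summable (fun n : ℕ => r ^ n / Real.sqrt n.factorial) := by
  have h1 : Summable (fun n : ℕ => (2 * r ^ 2) ^ n / (n.factorial : ℝ)) :=
    Real.summable_pow_div_factorial _
  have h2 : Summable (fun n : ℕ => (1/2 : ℝ) ^ n) := summable_geometric_two
  refine Summable.of_nonneg_of_le (fun n => by positivity) (fun n => ?_) (h1.add h2)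
  have hf : (0 : ℝ) < n.factorial := by positivity
  set a := r ^ n / Real.sqrt n.factorial with ha
  have ha2 : a ^ 2 = (r ^ 2) ^ n / (n.factorial : ℝ) := by
    rw [ha, div_pow, Real.sq_sqrt hf.le]; ring
  have h3 : (2 * r ^ 2) ^ n / (n.factorial : ℝ) = 2 ^ n * a ^ 2 := by
    rw [ha2, mul_pow]; ring
  rw [h3]
  have h4 : (1/2 : ℝ) ^ n = 1 / 2 ^ n := by simp
  rw [h4]
  have h5 : (0 : ℝ) < 2 ^ n := by positivity
  have h6 : 0 ≤ a := by positivity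
  have : 2 ^ n * a ^ 2 + 1 / 2 ^ n - 2 * a = (2 ^ n * a - 1) ^ 2 / 2 ^ n := by
    field_simp; ring
  have h7 : 0 ≤ (2 ^ n * a - 1) ^ 2 / (2 ^ n : ℝ) := by positivity
  linarith

lemma BB_hasSum {f : ℝ → ℂ} (hf : Dec f) (w : ℂ) :
    HasSum (fun n : ℕ => coef1 n f * (w ^ n / (Real.sqrt n.factorial : ℂ))) (BB f w) := by
  obtain ⟨M, hM⟩ := coef1_norm_bound hf
  have h := hasSum_integral_of_summable_integral_norm (μ := (volume : Measure ℝ))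
    (F := fun (n : ℕ) x => (w ^ n / (Real.sqrt n.factorial : ℂ)) * ((hermiteFn n x : ℂ) * f x))
    (fun n => (hermiteFn_mul_dec_integrable n hf).const_mul _)
    (by
      refine Summable.of_nonneg_of_le (fun n => by positivity) (fun n => ?_)
        ((summable_pow_div_sqrt_factorial ‖w‖ (norm_nonneg _)).mul_right M)
      simp_rw [norm_mul (w ^ n / _)]
      rw [integral_const_mul]
      have : ‖w ^ n / (Real.sqrt n.factorial : ℂ)‖ = ‖w‖ ^ n / Real.sqrt n.factorial := by
        simp [abs_of_nonneg]
      rw [this]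
      gcongr
      exact hM n)
  convert! h using 1
  · ext n; rw [coef1, integral_const_mul, mul_comm]
  · rw [BB]; congr 1; ext x
    rw [← (KK_hasSum x w).tsum_eq, ← tsum_mul_right]
    congr 1; ext n; ring

end

section

lemma circ_orth (m n : ℕ) : ∫ θ in Set.Ioo (-Real.pi) Real.pi, 
    Complex.exp (Complex.I * m * θ) * Complex.exp (-(Complex.I * n * θ)) = 
      if m = n then (2 * Real.pi : ℂ) else 0 := by
  rw [← integral_Ioc_eq_integral_Ioo, ← intervalIntegral.integral_of_le (by linarith [Real.pi_pos])]
  simp_rw [← Complex.exp_add]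
  split_ifs with h
  · subst h
    simp; ring
  · have hk : (Complex.I * (m - n) : ℂ) ≠ 0 := by
      refine mul_ne_zero Complex.I_ne_zero (sub_ne_zero.2 ?_)
      exact_mod_cast h
    have := integral_exp_mul_complex (a := -Real.pi) (b := Real.pi) hk
    have e : ∀ θ : ℝ, (Complex.I * m * θ + -(Complex.I * n * θ) : ℂ) = Complex.I * (m - n) * θ := by
      intro θ; ring
    simp_rw [e, this]
    rw [div_eq_zero_iff]; left
    rw [sub_eq_zero]
    rw [Complex.exp_eq_exp_iff_exists_int]
    refine ⟨(m : ℤ) - n, ?_⟩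
    push_cast; ring

lemma circ_parseval_real (a : ℕ → ℂ) (ha : Summable (fun n => ‖a n‖)) :
    HasSum (fun n => 2 * Real.pi * ‖a n‖ ^ 2) (∫ θ in Set.Ioo (-Real.pi) Real.pi, 
      ‖∑' n : ℕ, a n * Complex.exp (Complex.I * n * θ)‖ ^ 2) := by
  set μ := (volume : Measure ℝ).restrict (Set.Ioo (-Real.pi) Real.pi) with hμ
  have nrm : ∀ (n : ℕ) (θ : ℝ), ‖Complex.exp (Complex.I * n * θ)‖ = 1 := by
    intro n θ
    rw [show Complex.I * n * θ = ((n * θ : ℝ) : ℂ) * Complex.I by push_cast; ring]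
    exact Complex.norm_exp_ofReal_mul_I _
  have nrm' : ∀ (n : ℕ) (θ : ℝ), ‖Complex.exp (-(Complex.I * n * θ))‖ = 1 := by
    intro n θ
    rw [Complex.exp_neg, norm_inv, nrm, inv_one]
  set g : ℝ → ℂ := fun θ => ∑' n : ℕ, a n * Complex.exp (Complex.I * n * θ) with hg
  have gcont : Continuous g := by
    apply continuous_tsum (u := fun n => ‖a n‖)
    · intro n; fun_prop
    · exact ha
    · intro n θ; rw [norm_mul, nrm, mul_one]
  have gsum : ∀ θ : ℝ, Summable (fun n : ℕ => a n * Complex.exp (Complex.I * n * θ)) := by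
    intro θ
    apply Summable.of_norm
    simpa [nrm] using ha
  set M := ∑' n, ‖a n‖ with hM
  have gbd : ∀ θ, ‖g θ‖ ≤ M := by
    intro θ
    refine (norm_tsum_le_tsum_norm ?_).trans (le_of_eq ?_)
    · simpa [nrm] using ha
    · simp [nrm, hM]
  have step1 : ∀ n : ℕ, ∫ θ, g θ * Complex.exp (-(Complex.I * n * θ)) ∂μ = 2 * Real.pi * a n := by
    intro n
    have h := hasSum_integral_of_summable_integral_norm (μ := μ)
      (F := fun (m : ℕ) (θ : ℝ) => a m * (Complex.exp (Complex.I * m * θ) * 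
        Complex.exp (-(Complex.I * n * θ))))
      (fun m => by
        apply (integrable_const ‖a m‖).mono' (by fun_prop)
        filter_upwards with θ
        simp only [norm_mul, nrm, nrm', mul_one, le_refl])
      (by
        simp only [norm_mul, nrm, nrm', mul_one, integral_const]
        exact ha.const_smul _)
    have h2 : HasSum (fun m : ℕ => ∫ θ, a m * (Complex.exp (Complex.I * m * θ) * 
        Complex.exp (-(Complex.I * n * θ))) ∂μ) (2 * Real.pi * a n) := by
      have : (fun m : ℕ => ∫ θ, a m * (Complex.exp (Complex.I * m * θ) * 
        Complex.exp (-(Complex.I * n * θ))) ∂μ) = 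
          fun m => if m = n then 2 * Real.pi * a n else 0 := by
        ext m
        rw [integral_const_mul, hμ, circ_orth]
        split_ifs with h
        · rw [h]; ring
        · simp
      rw [this]
      exact hasSum_ite_eq n _
    rw [h2.unique h]
    congr 1
    ext θ
    rw [hg]
    simp only
    rw [← tsum_mul_right]
    congr 1; ext m; ring
  have h := hasSum_integral_of_summable_integral_norm (μ := μ)
      (F := fun (n : ℕ) (θ : ℝ) => (starRingEnd ℂ) (a n) * (g θ * Complex.exp (-(Complex.I * n * θ))))
      (fun m => by
        apply (integrable_const (‖a m‖ * M)).mono' (by fun_prop)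
        filter_upwards with θ
        simp only [norm_mul, nrm', mul_one, RCLike.norm_conj]
        gcongr
        exact gbd θ)
      (by
        simp only [norm_mul, nrm', mul_one, RCLike.norm_conj]
        simp_rw [integral_const_mul]
        exact ha.mul_right _)
  simp_rw [integral_const_mul, step1] at h
  have h3 : ∫ θ, ∑' n : ℕ, (starRingEnd ℂ) (a n) * (g θ * Complex.exp (-(Complex.I * n * θ))) ∂μ = 
      ((∫ θ, ‖g θ‖ ^ 2 ∂μ : ℝ) : ℂ) := by
    rw [← integral_complex_ofReal]
    congr 1
    ext θ
    have : ∀ n : ℕ, (starRingEnd ℂ) (a n) * (g θ * Complex.exp (-(Complex.I * n * θ))) = 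
        g θ * (starRingEnd ℂ) (a n * Complex.exp (Complex.I * n * θ)) := by
      intro n
      rw [map_mul, ← Complex.exp_conj]
      simp
      ring
    simp_rw [this]
    rw [tsum_mul_left]
    have e : ∑' n : ℕ, (starRingEnd ℂ) (a n * Complex.exp (Complex.I * n * θ)) = (starRingEnd ℂ) (g θ) := 
      ((Complex.hasSum_conj'.2 (by simpa using (gsum θ).hasSum))).tsum_eq
    rw [e, Complex.mul_conj, Complex.normSq_eq_norm_sq]
  rw [h3] at h
  rw [← Complex.hasSum_ofReal]
  convert! h using 1
  ext n
  push_cast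
  rw [← Complex.mul_conj']
  ring

lemma circ_parseval (a : ℕ → ℂ) (ha : Summable (fun n => ‖a n‖)) :
    ∫⁻ θ in Set.Ioo (-Real.pi) Real.pi, ‖∑' n : ℕ, a n * Complex.exp (Complex.I * n * θ)‖ₑ ^ 2 = 
      ∑' n : ℕ, ENNReal.ofReal (2 * Real.pi) * ‖a n‖ₑ ^ 2 := by
  have h := circ_parseval_real a ha
  have cont : Continuous (fun θ : ℝ => ∑' n : ℕ, a n * Complex.exp (Complex.I * n * θ)) := by
    apply continuous_tsum (u := fun n => ‖a n‖)
    · intro n; fun_prop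
    · exact ha
    · intro n θ
      rw [norm_mul, show Complex.I * n * θ = ((n * θ : ℝ) : ℂ) * Complex.I by push_cast; ring,
        Complex.norm_exp_ofReal_mul_I, mul_one]
  have e1 : ∀ z : ℂ, ‖z‖ₑ ^ 2 = ENNReal.ofReal (‖z‖ ^ 2) := by
    intro z
    rw [ENNReal.ofReal_pow (norm_nonneg _), ofReal_norm]
  simp_rw [e1]
  rw [← ofReal_integral_eq_lintegral_ofReal, ← h.tsum_eq, ENNReal.ofReal_tsum_of_nonneg]
  · congr 1; ext n
    rw [ENNReal.ofReal_mul (by positivity)]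
  · intro n; positivity
  · exact h.summable
  · have : IntegrableOn (fun θ : ℝ => ‖∑' n : ℕ, a n * Complex.exp (Complex.I * n * θ)‖ ^ 2) 
        (Set.Icc (-Real.pi) Real.pi) := by
      apply Continuous.integrableOn_Icc
      fun_prop
    exact this.mono_set Set.Ioo_subset_Icc_self
  · filter_upwards with θ
    positivity

lemma BB_measurable {f : ℝ → ℂ} (hf : Dec f) : Measurable (BB f) := by
  refine measurable_of_tendsto_metrizable (f := fun N w => ∑ n ∈ Finset.range N, 
    coef1 n f * (w ^ n / (Real.sqrt n.factorial : ℂ))) ?_ ?_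
  · intro N; fun_prop
  · rw [tendsto_pi_nhds]
    intro w
    exact (BB_hasSum hf w).tendsto_sum_nat

lemma coef1_bound {f : ℝ → ℂ} (hf : Dec f) : ∃ M : ℝ, ∀ n, ‖coef1 n f‖ ≤ M := by
  obtain ⟨M, hM⟩ := coef1_norm_bound hf
  exact ⟨M, fun n => (norm_integral_le_integral_norm _).trans (hM n)⟩

lemma BB_circ {f : ℝ → ℂ} (hf : Dec f) {r : ℝ} (hr : 0 < r) :
    ∫⁻ θ in Set.Ioo (-Real.pi) Real.pi, ‖BB f (r * Complex.exp (Complex.I * θ))‖ₑ ^ 2 = 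
      ∑' n : ℕ, ENNReal.ofReal (2 * Real.pi) * 
        (ENNReal.ofReal (r ^ (2 * n) / n.factorial) * ‖coef1 n f‖ₑ ^ 2) := by
  obtain ⟨M, hM⟩ := coef1_bound hf
  have key := circ_parseval (fun n => coef1 n f * (r ^ n / (Real.sqrt n.factorial : ℂ))) (by
    refine Summable.of_nonneg_of_le (fun n => norm_nonneg _) (fun n => ?_)
        ((summable_pow_div_sqrt_factorial r hr.le).mul_left M)
    rw [norm_mul]
    have : ‖(r : ℂ) ^ n / (Real.sqrt n.factorial : ℂ)‖ = r ^ n / Real.sqrt n.factorial := by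
      simp [abs_of_nonneg, abs_of_pos hr]
    rw [this]
    gcongr
    exact hM n)
  have e : ∀ θ : ℝ, BB f (r * Complex.exp (Complex.I * θ)) = ∑' n : ℕ, 
      (coef1 n f * (r ^ n / (Real.sqrt n.factorial : ℂ))) * Complex.exp (Complex.I * n * θ) := by
    intro θ
    rw [← (BB_hasSum hf _).tsum_eq]
    congr 1; ext n
    rw [mul_pow, ← Complex.exp_nat_mul, show (n : ℂ) * (Complex.I * θ) = Complex.I * n * θ by ring]
    ring
  simp_rw [e, key]
  congr 1; ext n
  congr 1
  rw [enorm_mul, mul_pow, mul_comm]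
  congr 1
  rw [← ofReal_norm, ← ENNReal.ofReal_pow (norm_nonneg _)]
  congr 1
  simp only [norm_div, norm_pow, Complex.norm_real, Real.norm_eq_abs, abs_of_pos hr]
  rw [abs_of_nonneg (Real.sqrt_nonneg _), div_pow, Real.sq_sqrt (by positivity)]
  ring

lemma BB_diag {f : ℝ → ℂ} (hf : Dec f) {s : ℝ} (hs : 0 ≤ s) :
    ∫⁻ w : ℂ, ENNReal.ofReal ((‖w‖ ^ 2) ^ s) * (ENNReal.ofReal (Real.exp (-‖w‖ ^ 2)) * ‖BB f w‖ₑ ^ 2) = 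
      ∑' n : ℕ, ENNReal.ofReal (Real.pi * (Real.Gamma (n + 1 + s) / n.factorial)) * 
        ‖coef1 n f‖ₑ ^ 2 := by
  have hBm := BB_measurable hf
  rw [← Complex.lintegral_comp_polarCoord_symm]
  rw [polarCoord_target, Measure.volume_eq_prod, ← Measure.prod_restrict]
  rw [lintegral_prod _ (by
    apply Measurable.aemeasurable
    have : Measurable (fun p : ℝ × ℝ => Complex.polarCoord.symm p) := by
      have : (fun p : ℝ × ℝ => Complex.polarCoord.symm p) = fun p => 
        (p.1 : ℂ) * (Real.cos p.2 + Real.sin p.2 * Complex.I) := by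
        ext p; rw [Complex.polarCoord_symm_apply]
      rw [this]; fun_prop
    fun_prop)]
  have e1 : ∀ r ∈ Set.Ioi (0 : ℝ), ∫⁻ θ in Set.Ioo (-Real.pi) Real.pi, 
      ENNReal.ofReal (r, θ).1 • (ENNReal.ofReal ((‖Complex.polarCoord.symm (r, θ)‖ ^ 2) ^ s) * 
        (ENNReal.ofReal (Real.exp (-‖Complex.polarCoord.symm (r, θ)‖ ^ 2)) * 
          ‖BB f (Complex.polarCoord.symm (r, θ))‖ₑ ^ 2)) = 
      ∑' n : ℕ, ENNReal.ofReal (2 * Real.pi / n.factorial * (r ^ (2 * n + 1 + 2 * s) * Real.exp (- r ^ (2 : ℝ)))) 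
        * ‖coef1 n f‖ₑ ^ 2 := by
    intro r hr
    have hr : 0 < r := hr
    have : ∀ θ : ℝ, Complex.polarCoord.symm (r, θ) = r * Complex.exp (Complex.I * θ) := by
      intro θ
      rw [Complex.polarCoord_symm_apply, mul_comm Complex.I, Complex.exp_mul_I]
      simp
    simp_rw [Complex.norm_polarCoord_symm, this, abs_of_pos hr, smul_eq_mul]
    simp_rw [← mul_assoc]
    rw [lintegral_const_mul _ (by fun_prop), BB_circ hf hr, ← ENNReal.tsum_mul_left]
    congr 1; ext n
    rw [← ENNReal.ofReal_mul hr.le, ← ENNReal.ofReal_mul (by positivity), ← mul_assoc, ← mul_assoc,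
      ← ENNReal.ofReal_mul (by positivity), ← ENNReal.ofReal_mul (by positivity)]
    congr 2
    rw [Real.rpow_add hr, Real.rpow_add hr, Real.rpow_mul hr.le 2 s]
    have : r ^ (2 * (n : ℝ)) = r ^ (2 * n) := by
      rw [← Real.rpow_natCast]; push_cast; rfl
    rw [this]
    simp
    ring
  rw [setLIntegral_congr_fun measurableSet_Ioi e1]
  rw [lintegral_tsum (by
    intro n
    apply Measurable.aemeasurable
    fun_prop)]
  congr 1; ext n
  rw [lintegral_mul_const _ (by fun_prop)]
  congr 1
  have hn : (0 : ℝ) ≤ n := n.cast_nonneg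
  have hq : (-1 : ℝ) < 2 * n + 1 + 2 * s := by linarith
  rw [← ofReal_integral_eq_lintegral_ofReal, integral_const_mul, 
    integral_rpow_mul_exp_neg_rpow (by norm_num) hq]
  · congr 1
    rw [show (2 * n + 1 + 2 * s + 1) / 2 = n + 1 + s by ring]
    ring
  · refine Integrable.const_mul ?_ _
    have := integrableOn_rpow_mul_exp_neg_rpow hq (p := 2) (by norm_num)
    exact this
  · refine (ae_restrict_iff' measurableSet_Ioi).2 ?_
    filter_upwards with r hr
    have hr : 0 < r := hr
    positivity

end

section

/-- Windowed Fourier transform. -/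
def UU (f : ℝ → ℂ) (a b : ℝ) : ℂ := 
  ∫ x : ℝ, Complex.exp (Complex.I * x * b) * ((Real.exp (-(x - 2 * a) ^ 2 / 4) : ℂ) * f x)

lemma norm_cexp_I (x b : ℝ) : ‖Complex.exp (Complex.I * x * b)‖ = 1 := by
  rw [show Complex.I * x * b = ((x * b : ℝ) : ℂ) * Complex.I by push_cast; ring]
  exact Complex.norm_exp_ofReal_mul_I _

lemma norm_cexp_negI (x b : ℝ) : ‖Complex.exp (-Complex.I * x * b)‖ = 1 := by
  rw [show -Complex.I * x * b = ((-(x * b) : ℝ) : ℂ) * Complex.I by push_cast; ring]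
  exact Complex.norm_exp_ofReal_mul_I _

lemma BB_eq_UU (f : ℝ → ℂ) (w : ℂ) : 
    ENNReal.ofReal (Real.exp (-‖w‖ ^ 2)) * ‖BB f w‖ₑ ^ 2 = 
      ENNReal.ofReal ((Real.sqrt (2 * Real.pi))⁻¹) * ‖UU f w.re w.im‖ₑ ^ 2 := by
  have h1 : (Real.exp (-‖w‖ ^ 2 / 2) : ℂ) * BB f w = 
      ((Real.sqrt (Real.sqrt (2 * Real.pi)))⁻¹ : ℝ) * Complex.exp (-(Complex.I * w.re * w.im)) * UU f w.re w.im := by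
    rw [BB, UU, ← integral_const_mul, ← integral_const_mul]
    congr 1; ext x
    rw [KK]
    have : (Real.exp (-‖w‖ ^ 2 / 2) : ℂ) * Complex.exp (-x ^ 2 / 4 + x * w - w ^ 2 / 2) = 
      Complex.exp (-(Complex.I * w.re * w.im)) * (Complex.exp (Complex.I * x * w.im) * 
        (Real.exp (-(x - 2 * w.re) ^ 2 / 4) : ℂ)) := by
      rw [Complex.ofReal_exp, Complex.ofReal_exp, ← Complex.exp_add, ← Complex.exp_add, 
        ← Complex.exp_add]
      congr 1
      rw [← Complex.normSq_eq_norm_sq, Complex.normSq_apply]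
      have hw := (Complex.re_add_im w).symm
      push_cast
      linear_combination ((x : ℂ) - (w + (w.re + w.im * Complex.I)) / 2) * hw -
        ((w.im : ℂ) ^ 2 / 2) * Complex.I_sq
    push_cast at this ⊢
    linear_combination (((Real.sqrt (Real.sqrt (2 * Real.pi))) : ℂ)⁻¹ * f x) * this
  have h2 : ‖Complex.exp (-(Complex.I * w.re * w.im))‖ = 1 := by
    rw [Complex.exp_neg, norm_inv, norm_cexp_I, inv_one]
  have h3 := congrArg (fun z => ‖z‖ₑ ^ 2) h1
  simp only [enorm_mul, mul_pow] at h3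
  have h4 : ‖Complex.exp (-(Complex.I * w.re * w.im))‖ₑ = 1 := by
    rw [← ofReal_norm, h2]; simp
  have h5 : ∀ r : ℝ, ‖(r : ℂ)‖ₑ ^ 2 = ENNReal.ofReal (r ^ 2) := by
    intro r
    rw [← ofReal_norm, ← ENNReal.ofReal_pow (norm_nonneg _)]; simp
  rw [h4, h5, h5] at h3
  rw [one_pow, mul_one, inv_pow, Real.sq_sqrt (by positivity), ← Real.exp_nat_mul] at h3
  convert h3 using 3
  push_cast; ring_nf

lemma window_dec {f : ℝ → ℂ} (hf : Dec f) (a : ℝ) : 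
    Dec (fun x => (Real.exp (-(x - 2 * a) ^ 2 / 4) : ℂ) * f x) := by
  obtain ⟨hc, C, hC⟩ := hf
  refine ⟨by fun_prop, C, fun x => ?_⟩
  rw [norm_mul, Complex.norm_real, Real.norm_of_nonneg (Real.exp_pos _).le]
  refine le_trans ?_ (hC x)
  refine mul_le_of_le_one_left (norm_nonneg _) ?_
  apply Real.exp_le_one_iff.2
  nlinarith [sq_nonneg (x - 2 * a)]

lemma lintegral_sq_window (f : ℝ → ℂ) (a x : ℝ) : 
    ‖(Real.exp (-(x - 2 * a) ^ 2 / 4) : ℂ) * f x‖ₑ ^ 2 = 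
      ENNReal.ofReal (Real.exp (-2 * (a - x / 2) ^ 2)) * ‖f x‖ₑ ^ 2 := by
  rw [enorm_mul, mul_pow]
  congr 1
  rw [← ofReal_norm, Complex.norm_real, Real.norm_of_nonneg (Real.exp_pos _).le,
    ← ENNReal.ofReal_pow (Real.exp_pos _).le, ← Real.exp_nat_mul]
  congr 2
  push_cast; ring

lemma UU_b {f : ℝ → ℂ} (hf : Dec f) (a : ℝ) :
    ∫⁻ b, ‖UU f a b‖ₑ ^ 2 = ENNReal.ofReal (2 * Real.pi) * 
      ∫⁻ x, ENNReal.ofReal (Real.exp (-2 * (a - x / 2) ^ 2)) * ‖f x‖ₑ ^ 2 := by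
  have h := plancherel (window_dec hf a)
  simp_rw [lintegral_sq_window] at h
  rw [← h, ← lintegral_neg_eq_self]
  apply lintegral_congr
  intro b
  congr 2
  rw [UU, ft]
  congr 1; ext x
  congr 2
  push_cast; ring

lemma UU_cont {f : ℝ → ℂ} (hf : Dec f) : Continuous (fun p : ℝ × ℝ => UU f p.1 p.2) := by
  have hfc := hf.1
  unfold UU
  apply continuous_of_dominated (bound := fun x => ‖f x‖)
  · intro p
    apply Continuous.aestronglyMeasurable
    fun_prop
  · intro p
    filter_upwards with x
    rw [norm_mul, norm_cexp_I, one_mul, norm_mul, Complex.norm_real, 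
      Real.norm_of_nonneg (Real.exp_pos _).le]
    refine mul_le_of_le_one_left (norm_nonneg _) ?_
    apply Real.exp_le_one_iff.2
    nlinarith [sq_nonneg (x - 2 * p.1)]
  · exact hf.integrable.norm
  · filter_upwards with x
    fun_prop

lemma gauss_quarter_integrable : Integrable (fun v : ℝ => (1 + v ^ 2) * Real.exp (-v ^ 2 / 4)) := by
  convert integrable_poly_gauss (1 + Polynomial.X ^ 2) (c := 1/4) (by norm_num) using 2
  simp; left; ring

lemma UU_dec {f : ℝ → ℂ} (hf : Dec f) (b : ℝ) : Dec (fun a => UU f a b) := by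
  refine ⟨(UU_cont hf).comp (by fun_prop : Continuous (fun a : ℝ => (a, b))), ?_⟩
  obtain ⟨hc, C, hC⟩ := hf
  have hC0 : 0 ≤ C := by simpa using (norm_nonneg _).trans (hC 0)
  refine ⟨2 * C * ∫ v : ℝ, (1 + v ^ 2) * Real.exp (-v ^ 2 / 4), fun a => ?_⟩
  have hinteg : Integrable (fun x : ℝ => (1 + (x - 2 * a) ^ 2) * Real.exp (-(x - 2 * a) ^ 2 / 4)) :=
    gauss_quarter_integrable.comp_sub_right (2 * a)
  calc ‖UU f a b‖ ≤ ∫ x : ℝ, (2 * C / (1 + a ^ 2)) * 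
        ((1 + (x - 2 * a) ^ 2) * Real.exp (-(x - 2 * a) ^ 2 / 4)) := by
        refine norm_integral_le_of_norm_le (hinteg.const_mul _) ?_
        filter_upwards with x
        rw [norm_mul, norm_cexp_I, one_mul, norm_mul, Complex.norm_real, 
          Real.norm_of_nonneg (Real.exp_pos _).le]
        have h1 := hC x
        have h2 : C / (1 + x ^ 2) ≤ 2 * C / (1 + a ^ 2) * (1 + (x - 2 * a) ^ 2) := by
          rw [div_mul_eq_mul_div, div_le_div_iff₀ (by positivity) (by positivity)]
          have : 1 + a ^ 2 ≤ 2 * ((1 + (x - 2 * a) ^ 2) * (1 + x ^ 2)) := by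
            nlinarith [sq_nonneg (x + (x - 2 * a)), sq_nonneg (x * (x - 2 * a)), sq_nonneg a, sq_nonneg x, sq_nonneg (x - 2 * a)]
          nlinarith
        calc _ ≤ Real.exp (-(x - 2 * a) ^ 2 / 4) * (2 * C / (1 + a ^ 2) * (1 + (x - 2 * a) ^ 2)) := by
              gcongr; exact h1.trans h2
          _ = _ := by ring
    _ = _ := by
        rw [integral_const_mul, integral_sub_right_eq_self (fun x : ℝ => (1 + x ^ 2) * Real.exp (-x ^ 2 / 4))]
        ring

lemma gauss_ft (x τ : ℝ) : ∫ a : ℝ, Complex.exp (-Complex.I * a * τ) * 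
    (Real.exp (-(x - 2 * a) ^ 2 / 4) : ℂ) = 
      (Real.sqrt Real.pi : ℂ) * Real.exp (-τ ^ 2 / 4) * Complex.exp (-Complex.I * x * (τ / 2)) := by
  have h := fourierIntegral_gaussian (b := 1) (by norm_num) (-τ : ℂ)
  rw [← integral_add_right_eq_self _ (x / 2)]
  calc _ = ∫ v : ℝ, Complex.exp (-Complex.I * x * (τ / 2)) * 
        (Complex.exp (Complex.I * (-τ) * v) * Complex.exp (-1 * v ^ 2)) := by
        congr 1; ext v
        rw [Complex.ofReal_exp, ← Complex.exp_add, ← Complex.exp_add, ← Complex.exp_add]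
        congr 1
        push_cast; ring
    _ = _ := by
        rw [integral_const_mul, h, Real.sqrt_eq_rpow, Complex.ofReal_cpow Real.pi_pos.le]
        push_cast
        rw [show -(-(τ : ℂ)) ^ 2 / (4 * 1) = -τ ^ 2 / 4 by ring, div_one]
        ring

lemma UU_ft {f : ℝ → ℂ} (hf : Dec f) (b τ : ℝ) : ft (fun a => UU f a b) τ = 
    (Real.sqrt Real.pi : ℂ) * Real.exp (-τ ^ 2 / 4) * ft f (τ / 2 - b) := by
  have hfc := hf.1
  have hI : Integrable (Function.uncurry fun (a x : ℝ) => Complex.exp (-Complex.I * a * τ) * 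
      (Complex.exp (Complex.I * x * b) * ((Real.exp (-(x - 2 * a) ^ 2 / 4) : ℂ) * f x))) 
      ((volume : Measure ℝ).prod volume) := by
    rw [integrable_prod_iff' (by
      apply Continuous.aestronglyMeasurable
      unfold Function.uncurry
      fun_prop)]
    have g0 : Integrable (fun a : ℝ => Real.exp (-1 * a ^ 2)) := 
      integrable_exp_neg_mul_sq (by norm_num)
    have g1 : ∀ x : ℝ, (fun a : ℝ => Real.exp (-(x - 2 * a) ^ 2 / 4)) = 
        fun a : ℝ => Real.exp (-1 * (a - x / 2) ^ 2) := by
      intro x; ext a; congr 1; ring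
    have nn : ∀ a x : ℝ, ‖Complex.exp (-Complex.I * a * τ) * 
      (Complex.exp (Complex.I * x * b) * ((Real.exp (-(x - 2 * a) ^ 2 / 4) : ℂ) * f x))‖ = 
        Real.exp (-(x - 2 * a) ^ 2 / 4) * ‖f x‖ := by
      intro a x
      rw [norm_mul, norm_cexp_negI, norm_mul, norm_cexp_I, norm_mul, Complex.norm_real, 
          Real.norm_of_nonneg (Real.exp_pos _).le]
      ring
    constructor
    · filter_upwards with x
      refine Integrable.mono' (g := fun a => Real.exp (-(x - 2 * a) ^ 2 / 4) * ‖f x‖) ?_ ?_ ?_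
      · refine Integrable.mul_const ?_ _
        rw [g1]
        exact g0.comp_sub_right (x / 2)
      · apply Continuous.aestronglyMeasurable
        unfold Function.uncurry
        fun_prop
      · filter_upwards with a
        exact (nn a x).le
    · simp only [Function.uncurry_apply_pair, nn]
      simp_rw [integral_mul_const]
      simp_rw [g1, integral_sub_right_eq_self (fun a : ℝ => Real.exp (-1 * a ^ 2))]
      exact hf.integrable.norm.const_mul _
  unfold ft UU
  simp_rw [← integral_const_mul]
  rw [integral_integral_swap hI]
  congr 1; ext x
  calc _ = ∫ a : ℝ, (Complex.exp (-Complex.I * a * τ) * 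
    (Real.exp (-(x - 2 * a) ^ 2 / 4) : ℂ)) * (Complex.exp (Complex.I * x * b) * f x) := by
        congr 1; ext a; ring
    _ = _ := by
        rw [integral_mul_const, gauss_ft]
        have : Complex.exp (-Complex.I * x * ((τ / 2 - b : ℝ) : ℂ)) = 
          Complex.exp (-Complex.I * x * (τ / 2)) * Complex.exp (Complex.I * x * b) := by
          rw [← Complex.exp_add]; congr 1; push_cast; ring
        rw [this]
        ring

lemma UU_a {f : ℝ → ℂ} (hf : Dec f) (b : ℝ) :
    ∫⁻ a, ‖UU f a b‖ₑ ^ 2 = 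
      ∫⁻ η, ENNReal.ofReal (Real.exp (-2 * (b + η) ^ 2)) * ‖ft f η‖ₑ ^ 2 := by
  have h := plancherel (UU_dec hf b)
  have hp : ENNReal.ofReal (2 * Real.pi) ≠ 0 := by 
    rw [Ne, ENNReal.ofReal_eq_zero, not_le]; positivity
  rw [← ENNReal.mul_right_inj hp ENNReal.ofReal_ne_top, ← h]
  rw [lintegral_scale _ (c := 2) (by norm_num)]
  rw [← lintegral_add_right_eq_self _ b]
  rw [ENNReal.ofReal_mul (by norm_num), mul_assoc]
  congr 1
  rw [← lintegral_const_mul' _ _ ENNReal.ofReal_ne_top]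
  apply lintegral_congr
  intro η
  rw [UU_ft hf, enorm_mul, mul_pow, ← mul_assoc]
  congr 1
  · rw [← Complex.ofReal_mul, ← ofReal_norm, Complex.norm_real, Real.norm_of_nonneg (by positivity),
      ← ENNReal.ofReal_pow (by positivity), mul_pow, Real.sq_sqrt Real.pi_pos.le, 
      ← ENNReal.ofReal_mul Real.pi_pos.le, ← Real.exp_nat_mul]
    congr 3
    push_cast; ring
  · congr 3; ring

end

section

lemma add_rpow_le' {x y s : ℝ} (hx : 0 ≤ x) (hy : 0 ≤ y) (hs : 0 ≤ s) :
    (x + y) ^ s ≤ 2 ^ s * (x ^ s + y ^ s) := by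
  wlog h : x ≤ y generalizing x y
  · rw [add_comm x y, add_comm (x ^ s)]
    exact this hy hx (le_of_not_ge h)
  calc (x + y) ^ s ≤ (2 * y) ^ s := by
        apply Real.rpow_le_rpow (by positivity) (by linarith) hs
    _ = 2 ^ s * y ^ s := Real.mul_rpow (by norm_num) hy
    _ ≤ _ := by
        gcongr
        linarith [Real.rpow_nonneg hx s]

/-- Japanese bracket weights. -/
def wt (s y : ℝ) : ℝ≥0∞ := ENNReal.ofReal ((1 + y ^ 2) ^ s)

@[fun_prop]
lemma wt_measurable (s : ℝ) : Measurable (wt s) := by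
  unfold wt; fun_prop

lemma peetre {s : ℝ} (hs : 0 ≤ s) (x y : ℝ) : (1 + x ^ 2) ^ s ≤ 2 ^ s * (1 + y ^ 2) ^ s * (1 + (x - y) ^ 2) ^ s := by
  rw [← Real.mul_rpow (by norm_num) (by positivity), ← Real.mul_rpow (by positivity) (by positivity)]
  apply Real.rpow_le_rpow (by positivity) _ hs
  nlinarith [sq_nonneg (y - (x - y)), sq_nonneg (y * (x - y))]

lemma gauss_wt_integrable (s : ℝ) : 
    Integrable (fun v : ℝ => (1 + v ^ 2) ^ s * Real.exp (-2 * v ^ 2)) := by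
  obtain ⟨k, hk⟩ := exists_nat_ge s
  have h := integrable_poly_gauss ((1 + Polynomial.X ^ 2) ^ k) (c := 2) (by norm_num)
  have hc : Continuous (fun v : ℝ => (1 + v ^ 2) ^ s * Real.exp (-2 * v ^ 2)) := by
    have : Continuous (fun v : ℝ => (1 + v ^ 2) ^ s) := by
      apply Continuous.rpow_const (by fun_prop)
      intro x; left; positivity
    fun_prop
  refine h.mono' hc.aestronglyMeasurable ?_
  filter_upwards with v
  rw [Real.norm_of_nonneg (by positivity)]
  simp only [Polynomial.eval_pow, Polynomial.eval_add, Polynomial.eval_one, Polynomial.eval_X]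
  have hle : (1 + v ^ 2) ^ s ≤ (1 + v ^ 2) ^ k := by
    rw [← Real.rpow_natCast (1 + v ^ 2) k]
    exact Real.rpow_le_rpow_of_exponent_le (x := 1 + v ^ 2) (by nlinarith [sq_nonneg v]) hk
  exact mul_le_mul_of_nonneg_right hle (Real.exp_nonneg _)

lemma gw_upper {s : ℝ} (hs : 0 ≤ s) : ∃ K : ℝ≥0, ∀ y : ℝ, 
    ∫⁻ b, wt s b * ENNReal.ofReal (Real.exp (-2 * (b - y) ^ 2)) ≤ K * wt s y := by
  set J := ∫⁻ v : ℝ, ENNReal.ofReal ((1 + v ^ 2) ^ s * Real.exp (-2 * v ^ 2)) with hJ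
  have hJt : J ≠ ⊤ := by
    have := (gauss_wt_integrable s).lintegral_lt_top
    exact this.ne
  refine ⟨(ENNReal.ofReal (2 ^ s) * J).toNNReal, fun y => ?_⟩
  rw [ENNReal.coe_toNNReal (ENNReal.mul_ne_top ENNReal.ofReal_ne_top hJt)]
  calc _ ≤ ∫⁻ b, (ENNReal.ofReal (2 ^ s) * wt s y) * ENNReal.ofReal ((1 + (b - y) ^ 2) ^ s * Real.exp (-2 * (b - y) ^ 2)) := by
        apply lintegral_mono
        intro b
        simp only [wt]
        rw [← ENNReal.ofReal_mul (by positivity), ← ENNReal.ofReal_mul (by positivity), ← ENNReal.ofReal_mul (by positivity)]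
        apply ENNReal.ofReal_le_ofReal
        rw [← mul_assoc]
        gcongr
        exact peetre hs b y
    _ = _ := by
        rw [lintegral_const_mul' (ENNReal.ofReal (2 ^ s) * wt s y) _
          (by unfold wt; exact ENNReal.mul_ne_top ENNReal.ofReal_ne_top ENNReal.ofReal_ne_top)]
        rw [lintegral_sub_right_eq_self (fun v : ℝ => ENNReal.ofReal ((1 + v ^ 2) ^ s * Real.exp (-2 * v ^ 2)))]
        rw [← hJ]; ring

lemma gw_lower {s : ℝ} (hs : 0 ≤ s) : ∃ K : ℝ≥0, ∀ y : ℝ, 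
    wt s y ≤ K * ∫⁻ b, wt s b * ENNReal.ofReal (Real.exp (-2 * (b - y) ^ 2)) := by
  refine ⟨(2 ^ s * 2 ^ s * Real.exp 2).toNNReal, fun y => ?_⟩
  change _ ≤ ENNReal.ofReal _ * _
  rw [← lintegral_const_mul' _ _ ENNReal.ofReal_ne_top]
  calc wt s y = ∫⁻ b in Set.Icc y (y + 1), wt s y := by simp
    _ ≤ ∫⁻ b in Set.Icc y (y + 1), ENNReal.ofReal (2 ^ s * 2 ^ s * Real.exp 2) * (wt s b * ENNReal.ofReal (Real.exp (-2 * (b - y) ^ 2))) := by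
        apply setLIntegral_mono' measurableSet_Icc
        intro b hb
        simp only [wt]
        rw [← ENNReal.ofReal_mul (by positivity), ← ENNReal.ofReal_mul (by positivity)]
        apply ENNReal.ofReal_le_ofReal
        have h1 : (b - y) ^ 2 ≤ 1 := by nlinarith [hb.1, hb.2]
        have h2 := peetre hs y b
        have h3 : (1 + (y - b) ^ 2) ^ s ≤ 2 ^ s := by
          apply Real.rpow_le_rpow (by positivity) (by nlinarith) hs
        have h4 : 1 ≤ Real.exp 2 * Real.exp (-2 * (b - y) ^ 2) := by
          rw [← Real.exp_add]; apply Real.one_le_exp; nlinarith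
        calc (1 + y ^ 2) ^ s ≤ 2 ^ s * (1 + b ^ 2) ^ s * 2 ^ s := h2.trans (by gcongr)
          _ ≤ (2 ^ s * (1 + b ^ 2) ^ s * 2 ^ s) * (Real.exp 2 * Real.exp (-2 * (b - y) ^ 2)) := 
            le_mul_of_one_le_right (by positivity) h4
          _ = _ := by ring
    _ ≤ _ := setLIntegral_le_lintegral _ _

lemma prod_Gamma {s : ℝ} (hs : 0 < s) (n : ℕ) : 
    (∏ j ∈ Finset.range (n + 1), (s + j)) * Real.Gamma s = Real.Gamma (n + 1 + s) := by
  induction n with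
  | zero => simp [add_comm, Real.Gamma_add_one hs.ne']
  | succ n ih =>
    rw [Finset.prod_range_succ]
    have : Real.Gamma ((n + 1 : ℕ) + 1 + s) = (n + 1 + s) * Real.Gamma (n + 1 + s) := by
      rw [← Real.Gamma_add_one (by positivity)]; congr 1; push_cast; ring
    rw [this, ← ih]
    push_cast; ring

lemma Gamma_ratio {s : ℝ} (hs : 0 ≤ s) : ∃ C : ℝ, 0 < C ∧ ∀ n : ℕ, 
    Real.Gamma (n + 1 + s) / n.factorial ≤ C * (n + 1 : ℝ) ^ s ∧ 
      (n + 1 : ℝ) ^ s ≤ C * (Real.Gamma (n + 1 + s) / n.factorial) := by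
  rcases hs.eq_or_lt with h0 | hs
  · subst h0
    refine ⟨1, one_pos, fun n => ?_⟩
    have : (n.factorial : ℝ) ≠ 0 := by positivity
    simp [Real.Gamma_nat_eq_factorial, this]
  set u : ℕ → ℝ := fun n => (n + 1 : ℝ) ^ s * n.factorial / Real.Gamma (n + 1 + s) with hu
  have hG : ∀ n : ℕ, 0 < Real.Gamma (n + 1 + s) := fun n => Real.Gamma_pos_of_pos (by positivity)
  have hpos : ∀ n, 0 < u n := by
    intro n
    have := hG n
    simp only [hu]; positivity
  have hlim : Filter.Tendsto u Filter.atTop (nhds 1) := by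
    have h1 := Real.GammaSeq_tendsto_Gamma s
    have h2 : Filter.Tendsto (fun n : ℕ => (1 + 1 / (n : ℝ)) ^ s) Filter.atTop (nhds ((1 + 0) ^ s)) := by
      apply Filter.Tendsto.rpow_const _ (by left; norm_num)
      exact tendsto_const_nhds.add tendsto_one_div_atTop_nhds_zero_nat
    have h3 := (h1.div_const (Real.Gamma s)).mul h2
    have hGs := Real.Gamma_pos_of_pos hs
    rw [div_self hGs.ne', add_zero, Real.one_rpow, mul_one] at h3
    refine h3.congr' ?_
    filter_upwards [Filter.eventually_ge_atTop 1] with n hn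
    have hn' : (0 : ℝ) < n := by exact_mod_cast hn
    simp only [hu, Real.GammaSeq]
    rw [← prod_Gamma hs n]
    have hp : (0 : ℝ) < ∏ j ∈ Finset.range (n + 1), (s + j) := by
      apply Finset.prod_pos; intro j _; positivity
    have : (n + 1 : ℝ) ^ s = n ^ s * (1 + 1 / (n : ℝ)) ^ s := by
      rw [← Real.mul_rpow hn'.le (by positivity)]; congr 1; field_simp
    rw [this]
    field_simp
  obtain ⟨A, hA⟩ := hlim.bddAbove_range
  obtain ⟨B, hB⟩ := (hlim.inv₀ one_ne_zero).bddAbove_range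
  refine ⟨|A| + |B| + 1, by positivity, fun n => ?_⟩
  have hA := hA ⟨n, rfl⟩
  have hB : (u n)⁻¹ ≤ B := hB ⟨n, rfl⟩
  have hf : (0 : ℝ) < n.factorial := by positivity
  have hr : (0 : ℝ) < (n + 1 : ℝ) ^ s := by positivity
  have e1 : Real.Gamma (n + 1 + s) / n.factorial = (u n)⁻¹ * (n + 1 : ℝ) ^ s := by
    have := (hG n).ne'
    simp only [hu]; field_simp
  have e2 : (n + 1 : ℝ) ^ s = u n * (Real.Gamma (n + 1 + s) / n.factorial) := by
    rw [e1, ← mul_assoc, mul_inv_cancel₀ (hpos n).ne', one_mul]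
  constructor
  · rw [e1]; gcongr
    linarith [le_abs_self B, abs_nonneg A]
  · have hq : 0 < Real.Gamma (n + 1 + s) / n.factorial := div_pos (hG n) hf
    calc _ = u n * (Real.Gamma (n + 1 + s) / n.factorial) := e2
      _ ≤ _ := by gcongr; linarith [le_abs_self A, abs_nonneg B]

end

section

/-- Gaussian-weighted density of the Bargmann transform. -/
def QQ (f : ℝ → ℂ) (w : ℂ) : ℝ≥0∞ := ENNReal.ofReal (Real.exp (-‖w‖ ^ 2)) * ‖BB f w‖ₑ ^ 2

lemma QQ_measurable {f : ℝ → ℂ} (hf : Dec f) : Measurable (QQ f) := by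
  unfold QQ
  have := BB_measurable hf
  fun_prop

def E1 (s : ℝ) (f : ℝ → ℂ) : ℝ≥0∞ := ∑' n : ℕ, ENNReal.ofReal ((n + 1 : ℝ) ^ s) * ‖coef1 n f‖ₑ ^ 2
def X1 (s : ℝ) (f : ℝ → ℂ) : ℝ≥0∞ := ∫⁻ x, wt s x * ‖f x‖ₑ ^ 2
def Xi1 (s : ℝ) (f : ℝ → ℂ) : ℝ≥0∞ := ∫⁻ x, wt s x * ‖ft f x‖ₑ ^ 2

lemma UU_meas {f : ℝ → ℂ} (hf : Dec f) : Measurable (fun p : ℝ × ℝ => ‖UU f p.1 p.2‖ₑ ^ 2) := by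
  have := (UU_cont hf).measurable
  fun_prop

lemma QQ_re {f : ℝ → ℂ} (hf : Dec f) (R : ℝ → ℝ≥0∞) (hR : Measurable R) :
    ∫⁻ w : ℂ, R w.re * QQ f w = ENNReal.ofReal ((Real.sqrt (2 * Real.pi))⁻¹) * (ENNReal.ofReal (2 * Real.pi) *
      ∫⁻ x, (∫⁻ a, R a * ENNReal.ofReal (Real.exp (-2 * (a - x / 2) ^ 2))) * ‖f x‖ₑ ^ 2) := by
  have hfm : Measurable f := hf.1.measurable
  have hm : Measurable (fun p : ℝ × ℝ => R p.1 * ‖UU f p.1 p.2‖ₑ ^ 2) := by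
    have := UU_meas hf
    fun_prop
  have e1 : ∀ w : ℂ, R w.re * QQ f w = ENNReal.ofReal ((Real.sqrt (2 * Real.pi))⁻¹) *
      (fun p : ℝ × ℝ => R p.1 * ‖UU f p.1 p.2‖ₑ ^ 2) (Complex.measurableEquivRealProd w) := by
    intro w
    rw [QQ, BB_eq_UU]
    simp only [Complex.measurableEquivRealProd_apply]
    ring
  simp_rw [e1]
  rw [lintegral_const_mul' _ _ ENNReal.ofReal_ne_top,
    Complex.volume_preserving_equiv_real_prod.lintegral_comp hm, Measure.volume_eq_prod,
    lintegral_prod _ hm.aemeasurable]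
  congr 1
  have e2 : ∀ a, ∫⁻ b, R a * ‖UU f a b‖ₑ ^ 2 = ENNReal.ofReal (2 * Real.pi) * 
     ∫⁻ x, R a * ENNReal.ofReal (Real.exp (-2 * (a - x / 2) ^ 2)) * ‖f x‖ₑ ^ 2 := by
    intro a
    rw [lintegral_const_mul, UU_b hf a]
    · rw [mul_left_comm, ← lintegral_const_mul _ (by fun_prop)]
      simp only [mul_assoc]
    · have := (UU_meas hf).comp (measurable_prodMk_left (x := a))
      exact this
  simp only
  simp_rw [e2]
  rw [lintegral_const_mul' _ _ ENNReal.ofReal_ne_top]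
  congr 1
  rw [lintegral_lintegral_swap (by fun_prop)]
  apply lintegral_congr
  intro x
  rw [lintegral_mul_const _ (by fun_prop)]

lemma ft_measurable {f : ℝ → ℂ} (hf : Dec f) : Continuous (ft f) := by
  unfold ft
  apply continuous_of_dominated (bound := fun x => ‖f x‖)
  · intro ξ
    have := hf.1
    exact Continuous.aestronglyMeasurable (by fun_prop)
  · intro ξ
    filter_upwards with x
    rw [norm_mul, norm_cexp_negI, one_mul]
  · exact hf.integrable.norm
  · filter_upwards with x
    fun_prop

lemma QQ_im {f : ℝ → ℂ} (hf : Dec f) (R : ℝ → ℝ≥0∞) (hR : Measurable R) :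
    ∫⁻ w : ℂ, R w.im * QQ f w = ENNReal.ofReal ((Real.sqrt (2 * Real.pi))⁻¹) * (
      ∫⁻ x, (∫⁻ b, R b * ENNReal.ofReal (Real.exp (-2 * (b + x) ^ 2))) * ‖ft f x‖ₑ ^ 2) := by
  have hfm : Measurable (ft f) := (ft_measurable hf).measurable
  have hm : Measurable (fun p : ℝ × ℝ => R p.2 * ‖UU f p.1 p.2‖ₑ ^ 2) := by
    have := UU_meas hf
    fun_prop
  have e1 : ∀ w : ℂ, R w.im * QQ f w = ENNReal.ofReal ((Real.sqrt (2 * Real.pi))⁻¹) *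
      (fun p : ℝ × ℝ => R p.2 * ‖UU f p.1 p.2‖ₑ ^ 2) (Complex.measurableEquivRealProd w) := by
    intro w
    rw [QQ, BB_eq_UU]
    simp only [Complex.measurableEquivRealProd_apply]
    ring
  simp_rw [e1]
  rw [lintegral_const_mul' _ _ ENNReal.ofReal_ne_top,
    Complex.volume_preserving_equiv_real_prod.lintegral_comp hm, Measure.volume_eq_prod,
    lintegral_prod_symm _ hm.aemeasurable]
  congr 1
  have e2 : ∀ b, ∫⁻ a, R b * ‖UU f a b‖ₑ ^ 2 = 
     ∫⁻ x, R b * ENNReal.ofReal (Real.exp (-2 * (b + x) ^ 2)) * ‖ft f x‖ₑ ^ 2 := by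
    intro b
    rw [lintegral_const_mul, UU_a hf b]
    · rw [← lintegral_const_mul _ (by fun_prop)]
      simp only [mul_assoc]
    · have := (UU_meas hf).comp (measurable_prodMk_right (y := b))
      exact this
  simp only
  simp_rw [e2]
  rw [lintegral_lintegral_swap (by fun_prop)]
  apply lintegral_congr
  intro x
  rw [lintegral_mul_const _ (by fun_prop)]

lemma wt_half_le {s : ℝ} (hs : 0 ≤ s) (x : ℝ) : wt s (x / 2) ≤ wt s x := by
  unfold wt
  apply ENNReal.ofReal_le_ofReal
  apply Real.rpow_le_rpow (by positivity) _ hs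
  nlinarith [sq_nonneg x]

lemma wt_le_half {s : ℝ} (hs : 0 ≤ s) (x : ℝ) : wt s x ≤ ENNReal.ofReal (4 ^ s) * wt s (x / 2) := by
  unfold wt
  rw [← ENNReal.ofReal_mul (by positivity), ← Real.mul_rpow (by norm_num) (by positivity)]
  apply ENNReal.ofReal_le_ofReal
  apply Real.rpow_le_rpow (by positivity) _ hs
  nlinarith [sq_nonneg x]

lemma wt_neg (s x : ℝ) : wt s (-x) = wt s x := by simp [wt]

lemma lintegral_le_const_mul {α : Type*} [MeasurableSpace α] {μ : Measure α} {f g : α → ℝ≥0∞} (K : ℝ≥0)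
    (h : ∀ x, f x ≤ K * g x) : ∫⁻ x, f x ∂μ ≤ K * ∫⁻ x, g x ∂μ := by
  rw [← lintegral_const_mul' _ _ ENNReal.coe_ne_top]
  exact lintegral_mono h

lemma tsum_le_const_mul {α : Type*} {f g : α → ℝ≥0∞} (K : ℝ≥0)
    (h : ∀ x, f x ≤ K * g x) : ∑' x, f x ≤ K * ∑' x, g x := by
  rw [← ENNReal.tsum_mul_left]
  exact ENNReal.tsum_le_tsum h

lemma Qre_upper {s : ℝ} (hs : 0 ≤ s) : ∃ K : ℝ≥0, ∀ f, Dec f → 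
    ∫⁻ w : ℂ, wt s w.re * QQ f w ≤ K * X1 s f := by
  obtain ⟨K, hK⟩ := gw_upper hs
  refine ⟨((Real.sqrt (2 * Real.pi))⁻¹).toNNReal * ((2 * Real.pi).toNNReal * K), fun f hf => ?_⟩
  rw [QQ_re hf _ (wt_measurable s)]
  push_cast
  rw [mul_assoc, mul_assoc]
  change _ ≤ ENNReal.ofReal _ * (ENNReal.ofReal _ * _)
  gcongr
  apply lintegral_le_const_mul
  intro x
  rw [← mul_assoc]
  gcongr
  exact (hK (x / 2)).trans (by gcongr; exact wt_half_le hs x)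

lemma Qim_upper {s : ℝ} (hs : 0 ≤ s) : ∃ K : ℝ≥0, ∀ f, Dec f → 
    ∫⁻ w : ℂ, wt s w.im * QQ f w ≤ K * Xi1 s f := by
  obtain ⟨K, hK⟩ := gw_upper hs
  refine ⟨((Real.sqrt (2 * Real.pi))⁻¹).toNNReal * K, fun f hf => ?_⟩
  rw [QQ_im hf _ (wt_measurable s)]
  push_cast
  rw [mul_assoc]
  change _ ≤ ENNReal.ofReal _ * (_)
  gcongr
  apply lintegral_le_const_mul
  intro x
  rw [← mul_assoc]
  gcongr
  have := (hK (-x)) 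
  rw [wt_neg] at this
  simpa using this

lemma Qre_lower {s : ℝ} (hs : 0 ≤ s) : ∃ K : ℝ≥0, ∀ f, Dec f → 
    X1 s f ≤ K * ∫⁻ w : ℂ, wt s w.re * QQ f w := by
  obtain ⟨K, hK⟩ := gw_lower hs
  refine ⟨(4 ^ s : ℝ).toNNReal * K * (Real.sqrt (2 * Real.pi)).toNNReal * ((2 * Real.pi)⁻¹).toNNReal, fun f hf => ?_⟩
  rw [QQ_re hf _ (wt_measurable s)]
  push_cast
  have hp : 0 < 2 * Real.pi := by positivity
  have e1 : ENNReal.ofReal (Real.sqrt (2 * Real.pi)) * ENNReal.ofReal (Real.sqrt (2 * Real.pi))⁻¹ = 1 := by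
    rw [← ENNReal.ofReal_mul (by positivity), mul_inv_cancel₀ (by positivity), ENNReal.ofReal_one]
  have e2 : ENNReal.ofReal (2 * Real.pi)⁻¹ * ENNReal.ofReal (2 * Real.pi) = 1 := by
    rw [← ENNReal.ofReal_mul (by positivity), inv_mul_cancel₀ (by positivity), ENNReal.ofReal_one]
  change _ ≤ ENNReal.ofReal (4 ^ s) * K * ENNReal.ofReal (Real.sqrt (2 * Real.pi)) * ENNReal.ofReal (2 * Real.pi)⁻¹ * _
  calc X1 s f ≤ (((4 ^ s : ℝ).toNNReal * K : ℝ≥0) : ℝ≥0∞) * ∫⁻ x, (∫⁻ a, wt s a * ENNReal.ofReal (Real.exp (-2 * (a - x / 2) ^ 2))) * ‖f x‖ₑ ^ 2 := by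
        apply lintegral_le_const_mul
        intro x
        rw [← mul_assoc]
        gcongr
        refine (wt_le_half hs x).trans ?_
        push_cast
        rw [mul_assoc]
        change _ ≤ ENNReal.ofReal _ * _
        gcongr
        exact hK (x / 2)
    _ = ENNReal.ofReal (4 ^ s) * K * (ENNReal.ofReal (Real.sqrt (2 * Real.pi)) * ENNReal.ofReal (Real.sqrt (2 * Real.pi))⁻¹) * (ENNReal.ofReal (2 * Real.pi)⁻¹ * ENNReal.ofReal (2 * Real.pi)) * _ := by
        rw [e1, e2]; push_cast; simp only [mul_one]; rfl
    _ = _ := by ring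

lemma Qim_lower {s : ℝ} (hs : 0 ≤ s) : ∃ K : ℝ≥0, ∀ f, Dec f → 
    Xi1 s f ≤ K * ∫⁻ w : ℂ, wt s w.im * QQ f w := by
  obtain ⟨K, hK⟩ := gw_lower hs
  refine ⟨K * (Real.sqrt (2 * Real.pi)).toNNReal, fun f hf => ?_⟩
  rw [QQ_im hf _ (wt_measurable s)]
  push_cast
  have hp : 0 < 2 * Real.pi := by positivity
  have e1 : ENNReal.ofReal (Real.sqrt (2 * Real.pi)) * ENNReal.ofReal (Real.sqrt (2 * Real.pi))⁻¹ = 1 := by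
    rw [← ENNReal.ofReal_mul (by positivity), mul_inv_cancel₀ (by positivity), ENNReal.ofReal_one]
  change _ ≤ K * ENNReal.ofReal (Real.sqrt (2 * Real.pi)) * _
  calc Xi1 s f ≤ K * ∫⁻ x, (∫⁻ a, wt s a * ENNReal.ofReal (Real.exp (-2 * (a + x) ^ 2))) * ‖ft f x‖ₑ ^ 2 := by
        apply lintegral_le_const_mul
        intro x
        rw [← mul_assoc]
        gcongr
        have := hK (-x)
        rw [wt_neg] at this
        simpa using this
    _ = K * (ENNReal.ofReal (Real.sqrt (2 * Real.pi)) * ENNReal.ofReal (Real.sqrt (2 * Real.pi))⁻¹) * _ := by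
        rw [e1]; simp only [mul_one]; rfl
    _ = _ := by ring

lemma E1_le {s : ℝ} (hs : 0 ≤ s) : ∃ K : ℝ≥0, ∀ f, Dec f → 
    E1 s f ≤ K * (X1 s f + Xi1 s f) := by
  obtain ⟨C, hC0, hC⟩ := Gamma_ratio hs
  obtain ⟨K1, h1⟩ := Qre_upper hs
  obtain ⟨K2, h2⟩ := Qim_upper hs
  refine ⟨(C / Real.pi).toNNReal * ((2 ^ s : ℝ).toNNReal * (K1 + K2)), fun f hf => ?_⟩
  have hpi := Real.pi_pos
  calc E1 s f ≤ ((C / Real.pi).toNNReal : ℝ≥0∞) * ∑' n : ℕ, ENNReal.ofReal (Real.pi * (Real.Gamma (n + 1 + s) / n.factorial)) * ‖coef1 n f‖ₑ ^ 2 := by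
        apply tsum_le_const_mul
        intro n
        rw [← mul_assoc]
        gcongr
        change _ ≤ ENNReal.ofReal _ * _
        rw [← ENNReal.ofReal_mul (by positivity)]
        apply ENNReal.ofReal_le_ofReal
        refine (hC n).2.trans (le_of_eq ?_)
        field_simp
    _ = ((C / Real.pi).toNNReal : ℝ≥0∞) * ∫⁻ w : ℂ, ENNReal.ofReal ((‖w‖ ^ 2) ^ s) * QQ f w := by
        rw [← BB_diag hf hs]; rfl
    _ ≤ ((C / Real.pi).toNNReal : ℝ≥0∞) * (((2 ^ s : ℝ).toNNReal : ℝ≥0∞) * ∫⁻ w : ℂ, (wt s w.re * QQ f w + wt s w.im * QQ f w)) := by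
        gcongr
        apply lintegral_le_const_mul
        intro w
        rw [← add_mul, ← mul_assoc]
        gcongr
        change _ ≤ ENNReal.ofReal _ * _
        unfold wt
        rw [← ENNReal.ofReal_add (by positivity) (by positivity), ← ENNReal.ofReal_mul (by positivity)]
        apply ENNReal.ofReal_le_ofReal
        refine le_trans ?_ (add_rpow_le' (by positivity) (by positivity) hs)
        apply Real.rpow_le_rpow (by positivity) _ hs
        rw [← Complex.normSq_eq_norm_sq, Complex.normSq_apply]
        nlinarith
    _ ≤ ((C / Real.pi).toNNReal : ℝ≥0∞) * (((2 ^ s : ℝ).toNNReal : ℝ≥0∞) * (K1 * (X1 s f + Xi1 s f) + K2 * (X1 s f + Xi1 s f))) := by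
        have hm := QQ_measurable hf
        rw [lintegral_add_left (by fun_prop)]
        gcongr
        · exact (h1 f hf).trans (by gcongr; exact le_self_add)
        · exact (h2 f hf).trans (by gcongr; exact le_add_self)
    _ = _ := by push_cast; ring

lemma le_E1 {s : ℝ} (hs : 0 ≤ s) : ∃ K : ℝ≥0, ∀ f, Dec f → 
    X1 s f + Xi1 s f ≤ K * E1 s f := by
  obtain ⟨C, hC0, hC⟩ := Gamma_ratio hs
  obtain ⟨K1, h1⟩ := Qre_lower hs
  obtain ⟨K2, h2⟩ := Qim_lower hs
  have hpi := Real.pi_pos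
  have main : ∃ K : ℝ≥0, ∀ f, Dec f → ∫⁻ w : ℂ, ENNReal.ofReal ((1 + ‖w‖ ^ 2) ^ s) * QQ f w ≤ K * E1 s f := by
    refine ⟨(2 ^ s : ℝ).toNNReal * (Real.pi.toNNReal + (Real.pi * C).toNNReal), fun f hf => ?_⟩
    have hm := QQ_measurable hf
    calc _ ≤ ((2 ^ s : ℝ).toNNReal : ℝ≥0∞) * ∫⁻ w : ℂ, (ENNReal.ofReal ((‖w‖ ^ 2) ^ (0 : ℝ)) * QQ f w + ENNReal.ofReal ((‖w‖ ^ 2) ^ s) * QQ f w) := by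
          apply lintegral_le_const_mul
          intro w
          rw [← add_mul, ← mul_assoc]
          gcongr
          change _ ≤ ENNReal.ofReal _ * _
          rw [← ENNReal.ofReal_add (by positivity) (by positivity), ← ENNReal.ofReal_mul (by positivity)]
          apply ENNReal.ofReal_le_ofReal
          refine (add_rpow_le' zero_le_one (by positivity) hs).trans ?_
          simp
      _ = ((2 ^ s : ℝ).toNNReal : ℝ≥0∞) * ((∑' n : ℕ, ENNReal.ofReal (Real.pi * (Real.Gamma (n + 1 + 0) / n.factorial)) * ‖coef1 n f‖ₑ ^ 2) + (∑' n : ℕ, ENNReal.ofReal (Real.pi * (Real.Gamma (n + 1 + s) / n.factorial)) * ‖coef1 n f‖ₑ ^ 2)) := by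
          rw [lintegral_add_left (by fun_prop), ← BB_diag hf hs, ← BB_diag hf le_rfl]; rfl
      _ ≤ ((2 ^ s : ℝ).toNNReal : ℝ≥0∞) * ((Real.pi.toNNReal : ℝ≥0∞) * E1 s f + ((Real.pi * C).toNNReal : ℝ≥0∞) * E1 s f) := by
          gcongr
          · apply tsum_le_const_mul
            intro n
            rw [← mul_assoc]
            gcongr
            change _ ≤ ENNReal.ofReal _ * _
            rw [← ENNReal.ofReal_mul (by positivity)]
            apply ENNReal.ofReal_le_ofReal
            have hn : (n.factorial : ℝ) ≠ 0 := by positivity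
            rw [add_zero, Real.Gamma_nat_eq_factorial, div_self hn]
            gcongr
            exact Real.one_le_rpow (by linarith [n.cast_nonneg (α := ℝ)]) hs
          · apply tsum_le_const_mul
            intro n
            rw [← mul_assoc]
            gcongr
            change _ ≤ ENNReal.ofReal _ * _
            rw [← ENNReal.ofReal_mul (by positivity)]
            apply ENNReal.ofReal_le_ofReal
            rw [mul_assoc]
            gcongr
            exact (hC n).1
      _ = _ := by push_cast; ring
  obtain ⟨K3, h3⟩ := main
  refine ⟨K1 * K3 + K2 * K3, fun f hf => ?_⟩
  push_cast
  rw [add_mul, mul_assoc, mul_assoc]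
  have hre : ∀ w : ℂ, w.re ^ 2 ≤ ‖w‖ ^ 2 := fun w => by
    rw [← Complex.normSq_eq_norm_sq, Complex.normSq_apply]; nlinarith [sq_nonneg w.im]
  have him : ∀ w : ℂ, w.im ^ 2 ≤ ‖w‖ ^ 2 := fun w => by
    rw [← Complex.normSq_eq_norm_sq, Complex.normSq_apply]; nlinarith [sq_nonneg w.re]
  gcongr
  · refine (h1 f hf).trans ?_
    gcongr
    refine le_trans ?_ (h3 f hf)
    gcongr with w
    exact ENNReal.ofReal_le_ofReal (Real.rpow_le_rpow (by positivity) (by linarith [hre w]) hs)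
  · refine (h2 f hf).trans ?_
    gcongr
    refine le_trans ?_ (h3 f hf)
    gcongr with w
    exact ENNReal.ofReal_le_ofReal (Real.rpow_le_rpow (by positivity) (by linarith [him w]) hs)

end

section

/-- Two-dimensional decay class. -/
def Dec2 (g : ℝ × ℝ → ℂ) : Prop := Continuous g ∧ ∃ C : ℝ, ∀ x, ‖g x‖ ≤ C / ((1 + x.1 ^ 2) * (1 + x.2 ^ 2))

lemma Dec2.bound {g : ℝ × ℝ → ℂ} (hg : Dec2 g) : ∃ C : ℝ, 0 ≤ C ∧ ∀ x, ‖g x‖ ≤ C * ((1 + x.1 ^ 2)⁻¹ * (1 + x.2 ^ 2)⁻¹) := by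
  obtain ⟨hc, C, hC⟩ := hg
  refine ⟨C, ?_, fun x => ?_⟩
  · have := (norm_nonneg _).trans (hC (0, 0)); simpa using this
  · rw [← mul_inv, ← div_eq_mul_inv]; exact hC x

lemma integrable_inv1 : Integrable (fun x : ℝ => (1 + x ^ 2)⁻¹) := integrable_inv_one_add_sq

lemma Dec2.integrable {g : ℝ × ℝ → ℂ} (hg : Dec2 g) : Integrable g := by
  obtain ⟨C, hC0, hC⟩ := hg.bound
  refine Integrable.mono' ((integrable_inv1.mul_prod integrable_inv1).const_mul C) hg.1.aestronglyMeasurable ?_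
  filter_upwards with x
  exact hC x

lemma Dec2.swap {g : ℝ × ℝ → ℂ} (hg : Dec2 g) : Dec2 (fun x => g x.swap) := by
  obtain ⟨hc, C, hC⟩ := hg
  refine ⟨by fun_prop, C, fun x => ?_⟩
  have := hC x.swap
  rwa [mul_comm, Prod.snd_swap, Prod.fst_swap] at this

lemma Dec2.slice {g : ℝ × ℝ → ℂ} (hg : Dec2 g) (y : ℝ) : Dec (fun x => g (x, y)) := by
  obtain ⟨C, hC0, hC⟩ := hg.bound
  have := hg.1
  refine ⟨by fun_prop, C, fun x => (hC (x, y)).trans ?_⟩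
  rw [div_eq_mul_inv]
  gcongr
  apply mul_le_of_le_one_right (by positivity)
  apply inv_le_one_of_one_le₀
  simp; positivity

/-- Integrating out the first variable against a kernel. -/
lemma Dec2.partial {g : ℝ × ℝ → ℂ} (hg : Dec2 g) {k : ℝ → ℂ} (hk : Continuous k) {M : ℝ} (hM : ∀ x, ‖k x‖ ≤ M) :
    Dec (fun y => ∫ x, k x * g (x, y)) := by
  obtain ⟨C, hC0, hC⟩ := hg.bound
  have hgc := hg.1
  have hM0 : 0 ≤ M := (norm_nonneg _).trans (hM 0)
  have hb : ∀ x y, ‖k x * g (x, y)‖ ≤ M * C * (1 + y ^ 2)⁻¹ * (1 + x ^ 2)⁻¹ := by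
    intro x y
    rw [norm_mul]
    calc _ ≤ M * (C * ((1 + x ^ 2)⁻¹ * (1 + y ^ 2)⁻¹)) := by
          gcongr
          · exact hM x
          · exact hC (x, y)
      _ = _ := by ring
  constructor
  · apply continuous_of_dominated (bound := fun x => M * C * (1 + x ^ 2)⁻¹)
    · intro y
      exact Continuous.aestronglyMeasurable (by fun_prop)
    · intro y
      filter_upwards with x
      refine (hb x y).trans ?_
      have h1 : (1 + y ^ 2)⁻¹ ≤ 1 := inv_le_one_of_one_le₀ (by nlinarith [sq_nonneg y])
      have h2 : M * C * (1 + y ^ 2)⁻¹ ≤ M * C := mul_le_of_le_one_right (by positivity) h1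
      exact mul_le_mul_of_nonneg_right h2 (by positivity)
    · exact integrable_inv1.const_mul _
    · filter_upwards with x
      fun_prop
  · refine ⟨∫ x : ℝ, M * C * (1 + x ^ 2)⁻¹, fun y => ?_⟩
    calc _ ≤ ∫ x : ℝ, M * C * (1 + y ^ 2)⁻¹ * (1 + x ^ 2)⁻¹ := by
          apply norm_integral_le_of_norm_le (integrable_inv1.const_mul _)
          filter_upwards with x
          exact hb x y
      _ = _ := by
          rw [integral_const_mul, integral_const_mul]; ring

lemma poly_gauss_bounded (p : Polynomial ℝ) : ∃ M : ℝ, ∀ x : ℝ, |p.eval x * Real.exp (-x ^ 2 / 4)| ≤ M := by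
  induction p using Polynomial.induction_on' with
  | add p q hp hq =>
    obtain ⟨A, hA⟩ := hp
    obtain ⟨B, hB⟩ := hq
    refine ⟨A + B, fun x => ?_⟩
    rw [Polynomial.eval_add, add_mul]
    exact (abs_add_le _ _).trans (add_le_add (hA x) (hB x))
  | monomial k a =>
    refine ⟨|a| * (1 + 4 ^ k * k.factorial), fun x => ?_⟩
    rw [Polynomial.eval_monomial, mul_assoc, abs_mul, abs_mul, abs_of_pos (Real.exp_pos _), abs_pow]
    gcongr
    have h1 := Real.pow_div_factorial_le_exp (x ^ 2 / 4) (by positivity) k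
    have h2 : |x| ^ k ≤ 1 + (x ^ 2) ^ k := by
      rw [← sq_abs x, ← pow_mul, mul_comm, pow_mul]
      nlinarith [sq_nonneg (|x| ^ k - 1)]
    have h3 : (x ^ 2) ^ k ≤ 4 ^ k * k.factorial * Real.exp (x ^ 2 / 4) := by
      rw [div_pow, div_div, div_le_iff₀ (by positivity)] at h1
      linarith
    have h4 : Real.exp (-x ^ 2 / 4) ≤ 1 := by
      rw [Real.exp_le_one_iff]; nlinarith [sq_nonneg x]
    have h5 : Real.exp (x ^ 2 / 4) * Real.exp (-x ^ 2 / 4) = 1 := by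
      rw [← Real.exp_add, neg_div, add_neg_cancel, Real.exp_zero]
    calc |x| ^ k * Real.exp (-x ^ 2 / 4) ≤ (1 + 4 ^ k * k.factorial * Real.exp (x ^ 2 / 4)) * Real.exp (-x ^ 2 / 4) := by
          gcongr; linarith
      _ = Real.exp (-x ^ 2 / 4) + 4 ^ k * k.factorial * (Real.exp (x ^ 2 / 4) * Real.exp (-x ^ 2 / 4)) := by ring
      _ ≤ _ := by rw [h5, mul_one]; linarith

lemma hermiteFn_bounded (n : ℕ) : ∃ M : ℝ, ∀ x, ‖((hermiteFn n x : ℝ) : ℂ)‖ ≤ M := by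
  obtain ⟨M, hM⟩ := poly_gauss_bounded ((Polynomial.hermite n).map (Int.castRingHom ℝ))
  refine ⟨M / Real.sqrt (Real.sqrt (2 * Real.pi) * (n.factorial : ℝ)), fun x => ?_⟩
  rw [Complex.norm_real, Real.norm_eq_abs, hermiteFn, abs_div, abs_of_nonneg (Real.sqrt_nonneg _)]
  gcongr
  have := hM x
  rw [Polynomial.eval_map] at this
  rw [hermitePolyR, Polynomial.aeval_def]
  exact this

/-- 2D Fourier transform. -/
def FT2 (g : ℝ × ℝ → ℂ) (ξ : ℝ × ℝ) : ℂ := ∫ x : ℝ × ℝ, cexp (-(I) * (x.1 * ξ.1 + x.2 * ξ.2)) * g x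

lemma norm_cexp2 (x ξ : ℝ × ℝ) : ‖cexp (-(I) * (x.1 * ξ.1 + x.2 * ξ.2))‖ = 1 := by
  have : -(I) * ((x.1 : ℂ) * ξ.1 + x.2 * ξ.2) = ((-(x.1 * ξ.1 + x.2 * ξ.2) : ℝ) : ℂ) * I := by
    push_cast; ring
  rw [this, Complex.norm_exp_ofReal_mul_I]

lemma FT2_cont {g : ℝ × ℝ → ℂ} (hg : Dec2 g) : Continuous (FT2 g) := by
  have := hg.1
  unfold FT2
  apply continuous_of_dominated (bound := fun x => ‖g x‖)
  · intro ξ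
    exact Continuous.aestronglyMeasurable (by fun_prop)
  · intro ξ
    filter_upwards with x
    rw [norm_mul, norm_cexp2, one_mul]
  · exact hg.integrable.norm
  · filter_upwards with x
    fun_prop

lemma FT2_swap (g : ℝ × ℝ → ℂ) (ξ : ℝ × ℝ) : FT2 (fun x => g x.swap) ξ = FT2 g ξ.swap := by
  unfold FT2
  rw [Measure.volume_eq_prod, ← integral_prod_swap]
  simp only [Prod.swap_swap, Prod.fst_swap, Prod.snd_swap]
  congr 1; ext x; congr 3; ring

lemma coefH_swap (g : ℝ × ℝ → ℂ) (m : ℕ × ℕ) : coefH m (fun x => g x.swap) = coefH m.swap g := by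
  unfold coefH herm2
  rw [Measure.volume_eq_prod, ← integral_prod_swap]
  simp only [Prod.swap_swap, Prod.fst_swap, Prod.snd_swap, mul_comm]

lemma FT2_eq {g : ℝ × ℝ → ℂ} (hg : Dec2 g) (ξ : ℝ × ℝ) : 
    FT2 g ξ = ft (fun y => ft (fun x => g (x, y)) ξ.1) ξ.2 := by
  have := hg.1
  unfold FT2 ft
  rw [Measure.volume_eq_prod, integral_prod_symm]
  · congr 1; ext y
    rw [← integral_const_mul]
    congr 1; ext x
    rw [← mul_assoc, ← Complex.exp_add]
    congr 2; push_cast; ring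
  · refine hg.integrable.norm.mono' (Continuous.aestronglyMeasurable (by fun_prop)) ?_
    filter_upwards with x
    rw [norm_mul, norm_cexp2, one_mul]

lemma coefH_eq {g : ℝ × ℝ → ℂ} (hg : Dec2 g) (m : ℕ × ℕ) : 
    coefH m g = coef1 m.2 (fun y => coef1 m.1 (fun x => g (x, y))) := by
  have := hg.1
  have h1 := hermiteFn_continuous m.1
  have h2 := hermiteFn_continuous m.2
  obtain ⟨M1, hM1⟩ := hermiteFn_bounded m.1
  obtain ⟨M2, hM2⟩ := hermiteFn_bounded m.2
  unfold coefH coef1 herm2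
  rw [Measure.volume_eq_prod, integral_prod_symm]
  · congr 1; ext y
    rw [← integral_const_mul]
    congr 1; ext x
    push_cast; ring
  · refine (hg.integrable.norm.const_mul (M1 * M2)).mono' (Continuous.aestronglyMeasurable (by fun_prop)) ?_
    filter_upwards with x
    rw [norm_mul]
    gcongr
    push_cast
    rw [norm_mul]
    have := (norm_nonneg _).trans (hM1 0)
    gcongr
    · exact hM1 _
    · exact hM2 _

lemma ft_slice_cont {g : ℝ × ℝ → ℂ} (hg : Dec2 g) : Continuous (fun p : ℝ × ℝ => ft (fun x => g (x, p.2)) p.1) := by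
  obtain ⟨C, hC0, hC⟩ := hg.bound
  have := hg.1
  unfold ft
  apply continuous_of_dominated (bound := fun x => C * (1 + x ^ 2)⁻¹)
  · intro ξ
    exact Continuous.aestronglyMeasurable (by fun_prop)
  · intro ξ
    filter_upwards with x
    rw [norm_mul, norm_cexp_negI, one_mul]
    refine (hC _).trans ?_
    gcongr
    apply mul_le_of_le_one_right (by positivity)
    apply inv_le_one_of_one_le₀
    simp; positivity
  · exact integrable_inv1.const_mul _
  · filter_upwards with x
    fun_prop

lemma ft_slice_dec {g : ℝ × ℝ → ℂ} (hg : Dec2 g) (ξ : ℝ) : Dec (fun y => ft (fun x => g (x, y)) ξ) :=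
  hg.partial (k := fun x => cexp (-(I) * x * ξ)) (by fun_prop) (M := 1) (fun x => (norm_cexp_negI x ξ).le)

lemma coef_slice_dec {g : ℝ × ℝ → ℂ} (hg : Dec2 g) (n : ℕ) : Dec (fun y => coef1 n (fun x => g (x, y))) := by
  obtain ⟨M, hM⟩ := hermiteFn_bounded n
  have := hermiteFn_continuous n
  exact hg.partial (k := fun x => (hermiteFn n x : ℂ)) (by fun_prop) hM

lemma wt_zero (x : ℝ) : wt 0 x = 1 := by simp [wt]

lemma E1_zero (f : ℝ → ℂ) : E1 0 f = ∑' n, ‖coef1 n f‖ₑ ^ 2 := by simp [E1]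

lemma parseval_le : ∃ K : ℝ≥0, ∀ f, Dec f → ∑' n, ‖coef1 n f‖ₑ ^ 2 ≤ K * ∫⁻ x, ‖f x‖ₑ ^ 2 := by
  obtain ⟨K, hK⟩ := E1_le le_rfl
  refine ⟨K * (1 + (2 * Real.pi).toNNReal), fun f hf => ?_⟩
  have := hK f hf
  rw [E1_zero, X1, Xi1] at this
  simp only [wt_zero, one_mul] at this
  rw [plancherel hf] at this
  refine this.trans (le_of_eq ?_)
  push_cast
  rw [mul_assoc, add_mul, one_mul]; rfl

lemma le_parseval : ∃ K : ℝ≥0, ∀ f, Dec f → ∫⁻ x, ‖f x‖ₑ ^ 2 ≤ K * ∑' n, ‖coef1 n f‖ₑ ^ 2 := by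
  obtain ⟨K, hK⟩ := le_E1 le_rfl
  refine ⟨K, fun f hf => ?_⟩
  have := hK f hf
  rw [E1_zero, X1, Xi1] at this
  simp only [wt_zero, one_mul] at this
  exact le_self_add.trans this

/-- the weighted coefficient sum in the first index -/
def EE (s : ℝ) (g : ℝ × ℝ → ℂ) : ℝ≥0∞ := ∑' m : ℕ × ℕ, ENNReal.ofReal ((m.1 + 1 : ℝ) ^ s) * ‖coefH m g‖ₑ ^ 2
def XX (s : ℝ) (g : ℝ × ℝ → ℂ) : ℝ≥0∞ := ∫⁻ x : ℝ × ℝ, wt s x.1 * ‖g x‖ₑ ^ 2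
def Xi2 (s : ℝ) (g : ℝ × ℝ → ℂ) : ℝ≥0∞ := ∫⁻ x : ℝ × ℝ, wt s x.1 * ‖FT2 g x‖ₑ ^ 2

lemma EE_eq {g : ℝ × ℝ → ℂ} (hg : Dec2 g) (s : ℝ) : EE s g = ∑' n : ℕ, ENNReal.ofReal ((n + 1 : ℝ) ^ s) * 
    ∑' k : ℕ, ‖coef1 k (fun y => coef1 n (fun x => g (x, y)))‖ₑ ^ 2 := by
  unfold EE
  rw [ENNReal.tsum_prod']
  simp_rw [ENNReal.tsum_mul_left, coefH_eq hg]

lemma mid_eq {g : ℝ × ℝ → ℂ} (hg : Dec2 g) (s : ℝ) : ∑' n : ℕ, ENNReal.ofReal ((n + 1 : ℝ) ^ s) * 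
    ∫⁻ y, ‖coef1 n (fun x => g (x, y))‖ₑ ^ 2 = ∫⁻ y, E1 s (fun x => g (x, y)) := by
  unfold E1
  rw [lintegral_tsum]
  · congr 1; ext n
    rw [lintegral_const_mul' _ _ ENNReal.ofReal_ne_top]
  · intro n
    have := (coef_slice_dec hg n).1.measurable
    exact ((this.enorm.pow_const 2).const_mul _).aemeasurable

lemma XX_eq {g : ℝ × ℝ → ℂ} (hg : Dec2 g) (s : ℝ) : ∫⁻ y, X1 s (fun x => g (x, y)) = XX s g := by
  have := hg.1.measurable
  unfold X1 XX
  rw [Measure.volume_eq_prod, lintegral_prod_symm _ (by fun_prop)]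

lemma XX_meas {g : ℝ × ℝ → ℂ} (hg : Dec2 g) (s : ℝ) : Measurable fun y => X1 s (fun x => g (x, y)) := by
  have := hg.1.measurable
  unfold X1
  have : Measurable (fun p : ℝ × ℝ => wt s p.1 * ‖g p‖ₑ ^ 2) := by fun_prop
  exact this.lintegral_prod_left'

lemma Xi_eq {g : ℝ × ℝ → ℂ} (hg : Dec2 g) (s : ℝ) : ENNReal.ofReal (2 * Real.pi) * ∫⁻ y, Xi1 s (fun x => g (x, y)) = Xi2 s g := by
  have h1 := (ft_slice_cont hg).measurable
  have h2 := (FT2_cont hg).measurable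
  unfold Xi1 Xi2
  rw [Measure.volume_eq_prod, lintegral_prod _ (by fun_prop)]
  rw [lintegral_lintegral_swap (by 
    have : Measurable (fun p : ℝ × ℝ => wt s p.1 * ‖ft (fun x => g (x, p.2)) p.1‖ₑ ^ 2) := by fun_prop
    exact (this.comp measurable_swap).aemeasurable)]
  rw [← lintegral_const_mul' _ _ ENNReal.ofReal_ne_top]
  apply lintegral_congr
  intro ξ
  have h3 := (ft_slice_dec hg ξ).1.measurable
  have h4 := (ft_measurable (ft_slice_dec hg ξ)).measurable
  simp_rw [FT2_eq hg]
  rw [lintegral_const_mul _ (by fun_prop), lintegral_const_mul _ (by fun_prop),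
    plancherel (ft_slice_dec hg ξ)]
  ring

lemma EE_le {s : ℝ} (hs : 0 ≤ s) : ∃ K : ℝ≥0, ∀ g, Dec2 g → EE s g ≤ K * (XX s g + Xi2 s g) := by
  obtain ⟨K1, h1⟩ := parseval_le
  obtain ⟨K2, h2⟩ := E1_le hs
  refine ⟨K1 * K2, fun g hg => ?_⟩
  have hpi : 1 ≤ ENNReal.ofReal (2 * Real.pi) := by
    rw [← ENNReal.ofReal_one]; apply ENNReal.ofReal_le_ofReal; linarith [Real.pi_gt_three]
  calc EE s g ≤ K1 * ∑' n : ℕ, ENNReal.ofReal ((n + 1 : ℝ) ^ s) * 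
    ∫⁻ y, ‖coef1 n (fun x => g (x, y))‖ₑ ^ 2 := by
        rw [EE_eq hg]
        apply tsum_le_const_mul
        intro n
        rw [mul_left_comm]
        gcongr
        exact h1 _ (coef_slice_dec hg n)
    _ ≤ K1 * (K2 * ∫⁻ y, (X1 s (fun x => g (x, y)) + Xi1 s (fun x => g (x, y)))) := by
        rw [mid_eq hg]
        gcongr
        apply lintegral_le_const_mul
        intro y
        exact h2 _ (hg.slice y)
    _ ≤ _ := by
        rw [lintegral_add_left (XX_meas hg s), XX_eq hg, ← Xi_eq hg]
        push_cast
        rw [mul_assoc]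
        gcongr
        exact le_mul_of_one_le_left (by positivity) hpi

lemma le_EE {s : ℝ} (hs : 0 ≤ s) : ∃ K : ℝ≥0, ∀ g, Dec2 g → XX s g + Xi2 s g ≤ K * EE s g := by
  obtain ⟨K1, h1⟩ := le_parseval
  obtain ⟨K2, h2⟩ := le_E1 hs
  refine ⟨(2 * Real.pi).toNNReal * K2 * K1, fun g hg => ?_⟩
  have hpi : 1 ≤ ENNReal.ofReal (2 * Real.pi) := by
    rw [← ENNReal.ofReal_one]; apply ENNReal.ofReal_le_ofReal; linarith [Real.pi_gt_three]
  calc XX s g + Xi2 s g ≤ ENNReal.ofReal (2 * Real.pi) * ∫⁻ y, (X1 s (fun x => g (x, y)) + Xi1 s (fun x => g (x, y))) := by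
        rw [lintegral_add_left (XX_meas hg s), XX_eq hg, ← Xi_eq hg, mul_add]
        gcongr
        exact le_mul_of_one_le_left (by positivity) hpi
    _ ≤ ENNReal.ofReal (2 * Real.pi) * (K2 * ∫⁻ y, E1 s (fun x => g (x, y))) := by
        gcongr
        apply lintegral_le_const_mul
        intro y
        exact h2 _ (hg.slice y)
    _ ≤ ENNReal.ofReal (2 * Real.pi) * (K2 * (K1 * EE s g)) := by
        rw [← mid_eq hg, EE_eq hg]
        gcongr
        apply tsum_le_const_mul
        intro n
        rw [mul_left_comm]
        gcongr
        exact h1 _ (coef_slice_dec hg n)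
    _ = _ := by push_cast; rw [ENNReal.ofReal]; ring

lemma plancherel2 {g : ℝ × ℝ → ℂ} (hg : Dec2 g) : 
    ENNReal.ofReal (2 * Real.pi) * (ENNReal.ofReal (2 * Real.pi) * XX 0 g) = Xi2 0 g := by
  rw [← Xi_eq hg, ← XX_eq hg, ← lintegral_const_mul' (ENNReal.ofReal (2 * Real.pi)) _ ENNReal.ofReal_ne_top]
  congr 1
  apply lintegral_congr
  intro y
  simp only [X1, Xi1, wt_zero, one_mul]
  rw [plancherel (hg.slice y)]

end

section

/-- Energy on the Hermite side at fixed `z`-frequency. -/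
def RR (s : ℝ) (g : ℝ × ℝ → ℂ) (ζ : ℝ) : ℝ≥0∞ :=
  ∑' m : ℕ × ℕ, ENNReal.ofReal ((((m.1 : ℝ) + m.2 + 1) / 2 + ζ ^ 2) ^ s) * ‖coefH m g‖ₑ ^ 2
def Wg (s : ℝ) (g : ℝ × ℝ → ℂ) : ℝ≥0∞ := ∫⁻ x : ℝ × ℝ, ENNReal.ofReal ((x.1 ^ 2 + x.2 ^ 2) ^ s) * ‖g x‖ₑ ^ 2
def Sg (s : ℝ) (g : ℝ × ℝ → ℂ) (ζ : ℝ) : ℝ≥0∞ := 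
  ∫⁻ x : ℝ × ℝ, ENNReal.ofReal ((1 + x.1 ^ 2 + x.2 ^ 2 + ζ ^ 2) ^ s) * ‖FT2 g x‖ₑ ^ 2

def sw (g : ℝ × ℝ → ℂ) : ℝ × ℝ → ℂ := fun x => g x.swap

lemma lintegral_sw (h : ℝ × ℝ → ℝ≥0∞) : ∫⁻ x : ℝ × ℝ, h x.swap = ∫⁻ x, h x := by
  rw [Measure.volume_eq_prod, lintegral_prod_swap]

lemma Wg_sw (s : ℝ) (g : ℝ × ℝ → ℂ) : Wg s (sw g) = Wg s g := by
  unfold Wg sw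
  rw [← lintegral_sw]
  simp only [Prod.swap_swap, Prod.fst_swap, Prod.snd_swap, add_comm]

lemma Sg_sw (s : ℝ) (g : ℝ × ℝ → ℂ) (ζ : ℝ) : Sg s (sw g) ζ = Sg s g ζ := by
  unfold Sg sw
  rw [← lintegral_sw]
  simp only [Prod.swap_swap, Prod.fst_swap, Prod.snd_swap, FT2_swap]
  congr 1; ext x; congr 3; ring

lemma XX_sw (s : ℝ) (g : ℝ × ℝ → ℂ) : XX s (sw g) = ∫⁻ x : ℝ × ℝ, wt s x.2 * ‖g x‖ₑ ^ 2 := by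
  unfold XX sw
  rw [← lintegral_sw]
  simp only [Prod.swap_swap, Prod.fst_swap]

lemma Xi2_sw (s : ℝ) (g : ℝ × ℝ → ℂ) : Xi2 s (sw g) = ∫⁻ x : ℝ × ℝ, wt s x.2 * ‖FT2 g x‖ₑ ^ 2 := by
  unfold Xi2 sw
  rw [← lintegral_sw]
  simp only [Prod.swap_swap, Prod.fst_swap, FT2_swap]

lemma EE_sw (s : ℝ) (g : ℝ × ℝ → ℂ) : EE s (sw g) = ∑' m : ℕ × ℕ, ENNReal.ofReal ((m.2 + 1 : ℝ) ^ s) * ‖coefH m g‖ₑ ^ 2 := by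
  unfold EE sw
  rw [← (Equiv.prodComm ℕ ℕ).tsum_eq]
  simp only [Equiv.prodComm_apply, Prod.fst_swap, coefH_swap, Prod.swap_swap]

lemma XX0_le {g : ℝ × ℝ → ℂ} (hg : Dec2 g) : XX 0 g ≤ Xi2 0 g := by
  have hpi : 1 ≤ ENNReal.ofReal (2 * Real.pi) := by
    rw [← ENNReal.ofReal_one]; apply ENNReal.ofReal_le_ofReal; linarith [Real.pi_gt_three]
  rw [← plancherel2 hg]
  exact (le_mul_of_one_le_left (by positivity) hpi).trans (le_mul_of_one_le_left (by positivity) hpi)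

lemma Xi2_le_Sg {s : ℝ} (hs : 0 ≤ s) (g : ℝ × ℝ → ℂ) (ζ : ℝ) : Xi2 s g ≤ Sg s g ζ := by
  unfold Xi2 Sg
  gcongr with x
  unfold wt
  exact ENNReal.ofReal_le_ofReal (Real.rpow_le_rpow (by positivity) (by nlinarith [sq_nonneg x.2, sq_nonneg ζ]) hs)

lemma wtXi2_le_Sg {s : ℝ} (hs : 0 ≤ s) (g : ℝ × ℝ → ℂ) (ζ : ℝ) : wt s ζ * Xi2 0 g ≤ Sg s g ζ := by
  unfold Xi2 Sg
  rw [← lintegral_const_mul' (wt s ζ) _ (by unfold wt; exact ENNReal.ofReal_ne_top)]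
  simp only [wt_zero, one_mul]
  gcongr with x
  unfold wt
  exact ENNReal.ofReal_le_ofReal (Real.rpow_le_rpow (by positivity) (by nlinarith [sq_nonneg x.2, sq_nonneg x.1]) hs)

lemma Xi20_le_Sg {s : ℝ} (hs : 0 ≤ s) (g : ℝ × ℝ → ℂ) (ζ : ℝ) : Xi2 0 g ≤ Sg s g ζ := by
  refine le_trans ?_ (wtXi2_le_Sg hs g ζ)
  refine le_mul_of_one_le_left (by positivity) ?_
  unfold wt
  rw [← ENNReal.ofReal_one]
  exact ENNReal.ofReal_le_ofReal (Real.one_le_rpow (by nlinarith [sq_nonneg ζ]) hs)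

lemma XXXi_le {s : ℝ} (hs : 0 ≤ s) : ∃ K : ℝ≥0, ∀ g, Dec2 g → ∀ ζ, XX s g + Xi2 s g ≤ K * (Wg s g + Sg s g ζ) := by
  refine ⟨(2 ^ s : ℝ).toNNReal + 1, fun g hg ζ => ?_⟩
  have hgm := hg.1.measurable
  have h1 : XX s g ≤ ((2 ^ s : ℝ).toNNReal : ℝ≥0∞) * (Sg s g ζ + Wg s g) := by
    calc XX s g ≤ ((2 ^ s : ℝ).toNNReal : ℝ≥0∞) * ∫⁻ x : ℝ × ℝ, (wt 0 x.1 * ‖g x‖ₑ ^ 2 + ENNReal.ofReal ((x.1 ^ 2 + x.2 ^ 2) ^ s) * ‖g x‖ₑ ^ 2) := by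
          apply lintegral_le_const_mul
          intro x
          rw [← add_mul, ← mul_assoc]
          gcongr
          change _ ≤ ENNReal.ofReal _ * _
          unfold wt
          rw [← ENNReal.ofReal_add (by positivity) (by positivity), ← ENNReal.ofReal_mul (by positivity)]
          apply ENNReal.ofReal_le_ofReal
          rw [Real.rpow_zero]
          have := add_rpow_le' zero_le_one (by positivity : 0 ≤ x.1 ^ 2 + x.2 ^ 2) hs
          rw [Real.one_rpow] at this
          refine le_trans ?_ this
          exact Real.rpow_le_rpow (by positivity) (by nlinarith [sq_nonneg x.2]) hs
      _ = ((2 ^ s : ℝ).toNNReal : ℝ≥0∞) * (XX 0 g + Wg s g) := by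
          rw [lintegral_add_left (by fun_prop)]; rfl
      _ ≤ _ := by
          gcongr
          exact (XX0_le hg).trans (Xi20_le_Sg hs g ζ)
  push_cast
  rw [add_mul, one_mul]
  rw [add_comm (Sg s g ζ)] at h1
  gcongr
  exact (Xi2_le_Sg hs g ζ).trans le_add_self

lemma RR_le {s : ℝ} (hs : 0 ≤ s) : ∃ K : ℝ≥0, ∀ g, Dec2 g → ∀ ζ, RR s g ζ ≤ K * (Wg s g + Sg s g ζ) := by
  obtain ⟨K1, h1⟩ := EE_le hs
  obtain ⟨K2, h2⟩ := XXXi_le hs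
  obtain ⟨K3, h3⟩ := EE_le le_rfl
  refine ⟨((2 ^ s * 2 ^ s : ℝ)).toNNReal * (K1 * K2 + K1 * K2 + K3 * 2), fun g hg ζ => ?_⟩
  calc RR s g ζ ≤ ((2 ^ s * 2 ^ s : ℝ).toNNReal : ℝ≥0∞) * (EE s g + EE s (sw g) + wt s ζ * EE 0 g) := by
        rw [EE_sw, EE, EE, ← ENNReal.tsum_mul_left, ← ENNReal.tsum_add, ← ENNReal.tsum_add]
        apply tsum_le_const_mul
        intro m
        rw [← add_mul, ← mul_assoc, ← add_mul, ← mul_assoc]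
        gcongr
        change _ ≤ ENNReal.ofReal _ * _
        unfold wt
        rw [Real.rpow_zero, ENNReal.ofReal_one, mul_one, ← ENNReal.ofReal_add (by positivity) (by positivity), ← ENNReal.ofReal_add (by positivity) (by positivity), ← ENNReal.ofReal_mul (by positivity)]
        apply ENNReal.ofReal_le_ofReal
        have a1 := add_rpow_le' (by positivity : (0 : ℝ) ≤ m.1 + 1) (by positivity : (0 : ℝ) ≤ m.2 + 1) hs
        have a2 := add_rpow_le' (by positivity : (0 : ℝ) ≤ (m.1 + 1) + (m.2 + 1)) (by positivity : (0 : ℝ) ≤ 1 + ζ ^ 2) hs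
        have h21 : (1 : ℝ) ≤ 2 ^ s := Real.one_le_rpow (by norm_num) hs
        have a3 : (((m.1 : ℝ) + m.2 + 1) / 2 + ζ ^ 2) ^ s ≤ ((m.1 + 1 : ℝ) + (m.2 + 1) + (1 + ζ ^ 2)) ^ s := by
          apply Real.rpow_le_rpow (by positivity) _ hs
          have := m.1.cast_nonneg (α := ℝ)
          have := m.2.cast_nonneg (α := ℝ)
          linarith
        refine a3.trans (a2.trans ?_)
        rw [mul_assoc]
        gcongr
        rw [mul_add]
        gcongr
        exact le_mul_of_one_le_left (by positivity) h21
    _ ≤ ((2 ^ s * 2 ^ s : ℝ).toNNReal : ℝ≥0∞) * (K1 * (K2 * (Wg s g + Sg s g ζ)) + K1 * (K2 * (Wg s g + Sg s g ζ)) + K3 * (2 * (Wg s g + Sg s g ζ))) := by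
        refine mul_le_mul' le_rfl (add_le_add (add_le_add ?_ ?_) ?_)
        · exact (h1 g hg).trans (by gcongr; exact h2 g hg ζ)
        · refine (h1 _ hg.swap).trans ?_
          have := h2 _ hg.swap ζ
          change _ ≤ K2 * (Wg s (sw g) + Sg s (sw g) ζ) at this
          rw [Wg_sw, Sg_sw] at this
          exact mul_le_mul' le_rfl this
        · calc wt s ζ * EE 0 g ≤ wt s ζ * (K3 * (Xi2 0 g + Xi2 0 g)) := by
                gcongr
                exact (h3 g hg).trans (by gcongr; exact XX0_le hg)
            _ = K3 * (2 * (wt s ζ * Xi2 0 g)) := by ring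
            _ ≤ _ := by
                gcongr
                exact (wtXi2_le_Sg hs g ζ).trans le_add_self
    _ = _ := by push_cast; ring

lemma le_RR {s : ℝ} (hs : 0 ≤ s) : ∃ K : ℝ≥0, ∀ g, Dec2 g → ∀ ζ, Wg s g + Sg s g ζ ≤ K * RR s g ζ := by
  obtain ⟨K1, h1⟩ := le_EE hs
  obtain ⟨K3, h3⟩ := le_EE le_rfl
  set c : ℝ≥0 := (2 ^ s : ℝ).toNNReal with hc
  have hcE : ∀ (x y : ℝ), 0 ≤ x → 0 ≤ y → x ≤ 2 * y → ENNReal.ofReal (x ^ s) ≤ c * ENNReal.ofReal (y ^ s) := by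
    intro x y hx hy h
    change _ ≤ ENNReal.ofReal _ * _
    rw [← ENNReal.ofReal_mul (by positivity), ← Real.mul_rpow (by norm_num) hy]
    exact ENNReal.ofReal_le_ofReal (Real.rpow_le_rpow hx h hs)
  refine ⟨c * (K1 * c + K1 * c) + c * c * (K1 * c + K1 * c + K3 * c), fun g hg ζ => ?_⟩
  have hgm := hg.1.measurable
  have hfm := (FT2_cont hg).measurable
  have e1 : EE s g ≤ c * RR s g ζ := by
    apply tsum_le_const_mul
    intro m
    rw [← mul_assoc]
    gcongr
    apply hcE _ _ (by positivity) (by positivity)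
    nlinarith [sq_nonneg ζ, m.2.cast_nonneg (α := ℝ)]
  have e2 : EE s (sw g) ≤ c * RR s g ζ := by
    rw [EE_sw]
    apply tsum_le_const_mul
    intro m
    rw [← mul_assoc]
    gcongr
    apply hcE _ _ (by positivity) (by positivity)
    nlinarith [sq_nonneg ζ, m.1.cast_nonneg (α := ℝ)]
  have e3 : wt s ζ * EE 0 g ≤ c * RR s g ζ := by
    rw [EE, ← ENNReal.tsum_mul_left]
    apply tsum_le_const_mul
    intro m
    rw [← mul_assoc, ← mul_assoc, Real.rpow_zero, ENNReal.ofReal_one, mul_one]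
    gcongr
    apply hcE _ _ (by positivity) (by positivity)
    nlinarith [sq_nonneg ζ, m.1.cast_nonneg (α := ℝ), m.2.cast_nonneg (α := ℝ)]
  have f1 : XX s g + Xi2 s g ≤ K1 * (c * RR s g ζ) := (h1 g hg).trans (by gcongr)
  have f2 : XX s (sw g) + Xi2 s (sw g) ≤ K1 * (c * RR s g ζ) := (h1 _ hg.swap).trans (by gcongr; exact e2)
  have f3 : wt s ζ * Xi2 0 g ≤ K3 * (c * RR s g ζ) := by
    calc _ ≤ wt s ζ * (K3 * EE 0 g) := by gcongr; exact le_add_self.trans (h3 g hg)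
      _ = K3 * (wt s ζ * EE 0 g) := by ring
      _ ≤ _ := by gcongr
  have g1 : Wg s g ≤ c * (XX s g + XX s (sw g)) := by
    rw [XX_sw, XX, ← lintegral_add_left (by fun_prop)]
    apply lintegral_le_const_mul
    intro x
    rw [← add_mul, ← mul_assoc]
    gcongr
    change _ ≤ ENNReal.ofReal _ * _
    unfold wt
    rw [← ENNReal.ofReal_add (by positivity) (by positivity), ← ENNReal.ofReal_mul (by positivity)]
    apply ENNReal.ofReal_le_ofReal
    refine le_trans ?_ (add_rpow_le' (by positivity) (by positivity) hs)
    exact Real.rpow_le_rpow (by positivity) (by linarith) hs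
  have g2 : Sg s g ζ ≤ ((c * c : ℝ≥0) : ℝ≥0∞) * (Xi2 s g + Xi2 s (sw g) + wt s ζ * Xi2 0 g) := by
    rw [Xi2_sw, Xi2, Xi2, ← lintegral_const_mul _ (by fun_prop), ← lintegral_add_left (by fun_prop), ← lintegral_add_left (by fun_prop)]
    apply lintegral_le_const_mul
    intro x
    rw [← add_mul, ← mul_assoc, wt_zero, mul_one, ← add_mul, ← mul_assoc]
    gcongr
    push_cast
    change _ ≤ ENNReal.ofReal _ * ENNReal.ofReal _ * _
    unfold wt
    rw [← ENNReal.ofReal_add (by positivity) (by positivity), ← ENNReal.ofReal_add (by positivity) (by positivity), ← ENNReal.ofReal_mul (by positivity), ← ENNReal.ofReal_mul (by positivity)]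
    apply ENNReal.ofReal_le_ofReal
    have a1 := add_rpow_le' (by positivity : (0 : ℝ) ≤ 1 + x.1 ^ 2) (by positivity : (0 : ℝ) ≤ 1 + x.2 ^ 2) hs
    have a2 := add_rpow_le' (by positivity : (0 : ℝ) ≤ (1 + x.1 ^ 2) + (1 + x.2 ^ 2)) (by positivity : (0 : ℝ) ≤ 1 + ζ ^ 2) hs
    have h21 : (1 : ℝ) ≤ 2 ^ s := Real.one_le_rpow (by norm_num) hs
    have a3 : (1 + x.1 ^ 2 + x.2 ^ 2 + ζ ^ 2) ^ s ≤ ((1 + x.1 ^ 2) + (1 + x.2 ^ 2) + (1 + ζ ^ 2)) ^ s := by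
      apply Real.rpow_le_rpow (by positivity) _ hs
      linarith
    refine a3.trans (a2.trans ?_)
    rw [mul_assoc]
    gcongr
    rw [mul_add]
    gcongr
    exact le_mul_of_one_le_left (by positivity) h21
  calc Wg s g + Sg s g ζ ≤ c * (K1 * (c * RR s g ζ) + K1 * (c * RR s g ζ)) + 
      ((c * c : ℝ≥0) : ℝ≥0∞) * (K1 * (c * RR s g ζ) + K1 * (c * RR s g ζ) + K3 * (c * RR s g ζ)) := by
        refine add_le_add (g1.trans ?_) (g2.trans ?_)
        · gcongr
          · exact le_self_add.trans f1
          · exact le_self_add.trans f2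
        · gcongr
          · exact le_add_self.trans f1
          · exact le_add_self.trans f2
    _ = _ := by push_cast; ring

end

section

/-- Three-dimensional decay class. -/
def Dec3 (F : (ℝ × ℝ) × ℝ → ℂ) : Prop := Continuous F ∧ ∃ C : ℝ, 0 ≤ C ∧ 
  ∀ p, ‖F p‖ ≤ C * ((1 + p.1.1 ^ 2)⁻¹ * (1 + p.1.2 ^ 2)⁻¹ * (1 + p.2 ^ 2)⁻¹)

lemma schwartz_dec3 (F : SchwartzMap ((ℝ × ℝ) × ℝ) ℂ) : Dec3 (fun p => F p) := by
  obtain ⟨A, hA0, hA⟩ := F.decay 0 0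
  obtain ⟨B, hB0, hB⟩ := F.decay 6 0
  refine ⟨F.continuous, 7 * (A + B), by positivity, fun p => ?_⟩
  have hA := hA p
  have hB := hB p
  simp only [norm_iteratedFDeriv_zero, pow_zero, one_mul] at hA hB
  rw [← mul_inv, ← mul_inv, ← div_eq_mul_inv, le_div_iff₀ (by positivity)]
  set t := ‖p‖ with ht
  have ht0 : 0 ≤ t := norm_nonneg _
  have h1 : p.1.1 ^ 2 ≤ t ^ 2 := by
    rw [← sq_abs]
    exact pow_le_pow_left₀ (abs_nonneg _) ((norm_fst_le p.1).trans (norm_fst_le p)) 2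
  have h2 : p.1.2 ^ 2 ≤ t ^ 2 := by
    rw [← sq_abs]
    exact pow_le_pow_left₀ (abs_nonneg _) ((norm_snd_le p.1).trans (norm_fst_le p)) 2
  have h3 : p.2 ^ 2 ≤ t ^ 2 := by
    rw [← sq_abs]
    exact pow_le_pow_left₀ (abs_nonneg _) (norm_snd_le p) 2
  have h4 : (1 + p.1.1 ^ 2) * (1 + p.1.2 ^ 2) * (1 + p.2 ^ 2) ≤ 7 * (1 + t ^ 6) := by
    calc _ ≤ (1 + t ^ 2) * (1 + t ^ 2) * (1 + t ^ 2) := by gcongr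
      _ ≤ _ := by
        rcases le_total t 1 with h | h
        · have a : t ^ 2 ≤ 1 := pow_le_one₀ ht0 h
          have b : t ^ 4 ≤ 1 := pow_le_one₀ ht0 h
          have c : 0 ≤ t ^ 6 := by positivity
          nlinarith
        · have a : t ^ 2 ≤ t ^ 6 := pow_le_pow_right₀ h (by norm_num)
          have b : t ^ 4 ≤ t ^ 6 := pow_le_pow_right₀ h (by norm_num)
          nlinarith
  calc _ ≤ ‖F p‖ * (7 * (1 + t ^ 6)) := by gcongr
    _ = 7 * (‖F p‖ + t ^ 6 * ‖F p‖) := by ring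
    _ ≤ _ := by gcongr

lemma inv_sq_le_one (x : ℝ) : (1 + x ^ 2)⁻¹ ≤ 1 := inv_le_one_of_one_le₀ (by nlinarith [sq_nonneg x])

lemma Dec3.slice {F : (ℝ × ℝ) × ℝ → ℂ} (hF : Dec3 F) (x : ℝ × ℝ) : Dec (fun z => F (x, z)) := by
  obtain ⟨hc, C, hC0, hC⟩ := hF
  refine ⟨by fun_prop, C, fun z => (hC (x, z)).trans ?_⟩
  rw [div_eq_mul_inv]
  gcongr
  refine mul_le_of_le_one_left (by positivity) ?_
  exact mul_le_one₀ (inv_sq_le_one _) (by positivity) (inv_sq_le_one _)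

lemma FTz_cont {F : (ℝ × ℝ) × ℝ → ℂ} (hF : Dec3 F) : Continuous (fun p : (ℝ × ℝ) × ℝ => FTz F p.1 p.2) := by
  obtain ⟨hc, C, hC0, hC⟩ := hF
  unfold FTz
  apply continuous_of_dominated (bound := fun z => C * (1 + z ^ 2)⁻¹)
  · intro ξ
    exact Continuous.aestronglyMeasurable (by fun_prop)
  · intro ξ
    filter_upwards with z
    rw [norm_mul, norm_cexp_negI, one_mul]
    refine (hC _).trans ?_
    gcongr
    refine mul_le_of_le_one_left (by positivity) ?_
    exact mul_le_one₀ (inv_sq_le_one _) (by positivity) (inv_sq_le_one _)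
  · exact integrable_inv1.const_mul _
  · filter_upwards with x
    fun_prop

lemma FTz_bound {F : (ℝ × ℝ) × ℝ → ℂ} (hF : Dec3 F) : ∃ C : ℝ, 0 ≤ C ∧ ∀ x ζ, 
    ‖FTz F x ζ‖ ≤ C / ((1 + x.1 ^ 2) * (1 + x.2 ^ 2)) := by
  obtain ⟨hc, C, hC0, hC⟩ := hF
  refine ⟨C * ∫ z : ℝ, (1 + z ^ 2)⁻¹, mul_nonneg hC0 (integral_nonneg fun z => by positivity), fun x ζ => ?_⟩
  unfold FTz
  calc _ ≤ ∫ z : ℝ, C * ((1 + x.1 ^ 2)⁻¹ * (1 + x.2 ^ 2)⁻¹) * (1 + z ^ 2)⁻¹ := by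
        apply norm_integral_le_of_norm_le (integrable_inv1.const_mul _)
        filter_upwards with z
        rw [norm_mul, norm_cexp_negI, one_mul]
        refine (hC _).trans (le_of_eq ?_)
        ring
    _ = _ := by
        rw [integral_const_mul, ← mul_inv]; ring

lemma FTz_dec2 {F : (ℝ × ℝ) × ℝ → ℂ} (hF : Dec3 F) (ζ : ℝ) : Dec2 (fun x => FTz F x ζ) := by
  obtain ⟨C, hC0, hC⟩ := FTz_bound hF
  have := FTz_cont hF
  refine ⟨?_, C, fun x => hC x ζ⟩
  exact this.comp (by fun_prop : Continuous fun x : ℝ × ℝ => (x, ζ))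

lemma Dec3.integrable {F : (ℝ × ℝ) × ℝ → ℂ} (hF : Dec3 F) : Integrable F := by
  obtain ⟨hc, C, hC0, hC⟩ := hF
  refine Integrable.mono' (((integrable_inv1.mul_prod integrable_inv1).mul_prod integrable_inv1).const_mul C) hc.aestronglyMeasurable ?_
  filter_upwards with x
  exact hC x

lemma norm_cexp3 (x ξ : (ℝ × ℝ) × ℝ) : ‖cexp (-(I) * (x.1.1 * ξ.1.1 + x.1.2 * ξ.1.2 + x.2 * ξ.2))‖ = 1 := by
  have : -(I) * ((x.1.1 : ℂ) * ξ.1.1 + x.1.2 * ξ.1.2 + x.2 * ξ.2) = ((-(x.1.1 * ξ.1.1 + x.1.2 * ξ.1.2 + x.2 * ξ.2) : ℝ) : ℂ) * I := by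
    push_cast; ring
  rw [this, Complex.norm_exp_ofReal_mul_I]

lemma FT3_eq {F : (ℝ × ℝ) × ℝ → ℂ} (hF : Dec3 F) (ξ : (ℝ × ℝ) × ℝ) : 
    FT3 F ξ = FT2 (fun x => FTz F x ξ.2) ξ.1 := by
  have := hF.1
  unfold FT3 FT2 FTz
  rw [Measure.volume_eq_prod, integral_prod]
  · congr 1; ext x
    rw [← integral_const_mul]
    congr 1; ext z
    rw [← mul_assoc, ← Complex.exp_add]
    congr 2; push_cast; ring
  · refine hF.integrable.norm.mono' (Continuous.aestronglyMeasurable (by fun_prop)) ?_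
    filter_upwards with x
    rw [norm_mul, norm_cexp3, one_mul]

lemma FT3_cont {F : (ℝ × ℝ) × ℝ → ℂ} (hF : Dec3 F) : Continuous (FT3 F) := by
  have := hF.1
  unfold FT3
  apply continuous_of_dominated (bound := fun x => ‖F x‖)
  · intro ξ
    exact Continuous.aestronglyMeasurable (by fun_prop)
  · intro ξ
    filter_upwards with x
    rw [norm_mul, norm_cexp3, one_mul]
  · exact hF.integrable.norm
  · filter_upwards with x
    fun_prop

lemma half_sq (x : ℝ≥0∞) : (x ^ ((1 : ℝ) / 2)) ^ 2 = x := by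
  rw [← ENNReal.rpow_natCast, ← ENNReal.rpow_mul]; norm_num

lemma SobNorm_sq {F : (ℝ × ℝ) × ℝ → ℂ} (hF : Dec3 F) (s : ℝ) : 
    SobNorm s F ^ 2 = ∫⁻ ζ, Sg s (fun x => FTz F x ζ) ζ := by
  have := (FT3_cont hF).measurable
  unfold SobNorm Sg
  rw [half_sq, Measure.volume_eq_prod, lintegral_prod_symm]
  · apply lintegral_congr; intro ζ
    apply lintegral_congr; intro x
    rw [FT3_eq hF]; rfl
  · change AEMeasurable (fun ξ : (ℝ × ℝ) × ℝ => ENNReal.ofReal ((1 + ξ.1.1 ^ 2 + ξ.1.2 ^ 2 + ξ.2 ^ 2) ^ s) * ‖FT3 F ξ‖ₑ ^ 2) _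
    fun_prop

lemma WtNorm_sq {F : (ℝ × ℝ) × ℝ → ℂ} (hF : Dec3 F) (s : ℝ) : 
    ENNReal.ofReal (2 * Real.pi) * WtNorm s F ^ 2 = ∫⁻ ζ, Wg s (fun x => FTz F x ζ) := by
  have h1 := hF.1.measurable
  have h2 := (FTz_cont hF).measurable
  unfold WtNorm Wg
  have e : ∀ p : (ℝ × ℝ) × ℝ, ‖(((p.1.1 ^ 2 + p.1.2 ^ 2) ^ (s / 2) : ℝ) : ℂ) * F p‖ₑ ^ 2 = 
     ENNReal.ofReal ((p.1.1 ^ 2 + p.1.2 ^ 2) ^ s) * ‖F p‖ₑ ^ 2 := by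
    intro p
    rw [enorm_mul, mul_pow, ← ofReal_norm, Complex.norm_real, Real.norm_of_nonneg (by positivity), 
      ← ENNReal.ofReal_pow (by positivity), ← Real.rpow_natCast, ← Real.rpow_mul (by positivity)]
    congr 3; push_cast; ring
  rw [eLpNorm_two_sq]
  simp_rw [e]
  rw [lintegral_lintegral_swap (by
    have : Measurable (fun p : (ℝ × ℝ) × ℝ => ENNReal.ofReal ((p.1.1 ^ 2 + p.1.2 ^ 2) ^ s) * ‖FTz F p.1 p.2‖ₑ ^ 2) := by fun_prop
    exact (this.comp measurable_swap).aemeasurable)]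
  rw [Measure.volume_eq_prod (ℝ × ℝ) ℝ, lintegral_prod _ (by fun_prop)]
  rw [← lintegral_const_mul' _ _ ENNReal.ofReal_ne_top]
  apply lintegral_congr; intro x
  simp only
  rw [lintegral_const_mul' _ _ ENNReal.ofReal_ne_top, lintegral_const_mul' _ _ ENNReal.ofReal_ne_top]
  have := plancherel (hF.slice x)
  change ∫⁻ ζ, ‖FTz F x ζ‖ₑ ^ 2 = _ at this
  rw [this]; ring

lemma Wg_meas {F : (ℝ × ℝ) × ℝ → ℂ} (hF : Dec3 F) (s : ℝ) : Measurable (fun ζ => Wg s (fun x => FTz F x ζ)) := by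
  have h2 := (FTz_cont hF).measurable
  unfold Wg
  have : Measurable (fun p : (ℝ × ℝ) × ℝ => ENNReal.ofReal ((p.1.1 ^ 2 + p.1.2 ^ 2) ^ s) * ‖FTz F p.1 p.2‖ₑ ^ 2) := by fun_prop
  exact this.lintegral_prod_left'

/-- The spectral energy. -/
def TT (s : ℝ) (F : (ℝ × ℝ) × ℝ → ℂ) : ℝ≥0∞ := ∫⁻ ζ, RR s (fun x => FTz F x ζ) ζ

lemma TT_le {s : ℝ} (hs : 0 ≤ s) : ∃ K : ℝ≥0, ∀ F, Dec3 F → TT s F ≤ K * (SobNorm s F ^ 2 + WtNorm s F ^ 2) := by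
  obtain ⟨K, hK⟩ := RR_le hs
  refine ⟨K * (2 * Real.pi).toNNReal, fun F hF => ?_⟩
  have hpi : 1 ≤ ENNReal.ofReal (2 * Real.pi) := by
    rw [← ENNReal.ofReal_one]; apply ENNReal.ofReal_le_ofReal; linarith [Real.pi_gt_three]
  calc TT s F ≤ K * ∫⁻ ζ, (Wg s (fun x => FTz F x ζ) + Sg s (fun x => FTz F x ζ) ζ) := by
        apply lintegral_le_const_mul
        intro ζ
        exact hK _ (FTz_dec2 hF ζ) ζ
    _ ≤ _ := by
        rw [lintegral_add_left (Wg_meas hF s), ← WtNorm_sq hF, ← SobNorm_sq hF]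
        push_cast
        rw [mul_assoc, add_comm]
        gcongr
        change _ ≤ ENNReal.ofReal _ * _
        rw [mul_add]
        gcongr
        exact le_mul_of_one_le_left (by positivity) hpi

lemma le_TT {s : ℝ} (hs : 0 ≤ s) : ∃ K : ℝ≥0, ∀ F, Dec3 F → SobNorm s F ^ 2 + WtNorm s F ^ 2 ≤ K * TT s F := by
  obtain ⟨K, hK⟩ := le_RR hs
  refine ⟨K, fun F hF => ?_⟩
  have hpi : 1 ≤ ENNReal.ofReal (2 * Real.pi) := by
    rw [← ENNReal.ofReal_one]; apply ENNReal.ofReal_le_ofReal; linarith [Real.pi_gt_three]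
  calc _ ≤ ∫⁻ ζ, (Wg s (fun x => FTz F x ζ) + Sg s (fun x => FTz F x ζ) ζ) := by
        rw [lintegral_add_left (Wg_meas hF s), ← WtNorm_sq hF, ← SobNorm_sq hF, add_comm]
        gcongr
        exact le_mul_of_one_le_left (by positivity) hpi
    _ ≤ _ := by
        apply lintegral_le_const_mul
        intro ζ
        exact hK _ (FTz_dec2 hF ζ) ζ

end

section

lemma dec_of_compact {f : ℝ → ℂ} (hf : Continuous f) {R : ℝ} (h : ∀ x, R < |x| → f x = 0) : Dec f := by
  obtain ⟨C, hC⟩ := (isCompact_Icc (a := -R) (b := R)).exists_bound_of_continuousOn 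
    (f := fun x : ℝ => ((1 + x ^ 2 : ℝ) : ℂ) * f x) (by fun_prop)
  refine ⟨hf, |C|, fun x => ?_⟩
  rw [le_div_iff₀ (by positivity)]
  by_cases hx : R < |x|
  · rw [h x hx]; simp
  · have := hC x (abs_le.1 (not_lt.1 hx))
    rw [norm_mul, Complex.norm_real, Real.norm_of_nonneg (by positivity)] at this
    rw [mul_comm]
    exact this.trans (le_abs_self C)

lemma herm2_cont (m : ℕ × ℕ) : Continuous (herm2 m) := by
  have h1 := hermiteFn_continuous m.1
  have h2 := hermiteFn_continuous m.2
  unfold herm2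
  fun_prop

lemma herm2_mul_integrable (m n : ℕ × ℕ) : Integrable (fun x => herm2 m x * herm2 n x) := by
  have := (hermiteFn_mul_integrable m.1 n.1).mul_prod (hermiteFn_mul_integrable m.2 n.2)
  refine this.congr ?_
  filter_upwards with x
  simp only [herm2]; ring

lemma herm2_orthonormal (m n : ℕ × ℕ) : ∫ x, herm2 m x * herm2 n x = if m = n then 1 else 0 := by
  have e : ∀ x : ℝ × ℝ, herm2 m x * herm2 n x = (hermiteFn m.1 x.1 * hermiteFn n.1 x.1) * (hermiteFn m.2 x.2 * hermiteFn n.2 x.2) := by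
    intro x; simp only [herm2]; ring
  simp_rw [e]
  rw [Measure.volume_eq_prod, integral_prod_mul (fun x => hermiteFn m.1 x * hermiteFn n.1 x) (fun x => hermiteFn m.2 x * hermiteFn n.2 x), hermiteFn_orthonormal, hermiteFn_orthonormal]
  simp only [Prod.ext_iff]
  split_ifs <;> simp_all

lemma herm2_sum_norm (S : Finset (ℕ × ℕ)) (b : ℕ × ℕ → ℂ) : 
    ∫⁻ x : ℝ × ℝ, ‖∑ m ∈ S, (herm2 m x : ℂ) * b m‖ₑ ^ 2 = ∑ m ∈ S, ‖b m‖ₑ ^ 2 := by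
  have key : ∀ x : ℝ × ℝ, ((‖∑ m ∈ S, (herm2 m x : ℂ) * b m‖ ^ 2 : ℝ) : ℂ) = 
      ∑ m ∈ S, ∑ n ∈ S, ((herm2 m x * herm2 n x : ℝ) : ℂ) * (b m * (starRingEnd ℂ) (b n)) := by
    intro x
    push_cast
    rw [← Complex.mul_conj', map_sum, Finset.sum_mul_sum]
    refine Finset.sum_congr rfl fun m _ => Finset.sum_congr rfl fun n _ => ?_
    rw [map_mul, Complex.conj_ofReal]; ring
  have hinteg : ∀ m n, Integrable (fun x => ((herm2 m x * herm2 n x : ℝ) : ℂ) * (b m * (starRingEnd ℂ) (b n))) := 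
    fun m n => (herm2_mul_integrable m n).ofReal.mul_const _
  have hI : Integrable (fun x => ((‖∑ m ∈ S, (herm2 m x : ℂ) * b m‖ ^ 2 : ℝ) : ℂ)) := by
    simp_rw [key]
    exact integrable_finsetSum _ fun m _ => integrable_finsetSum _ fun n _ => hinteg m n
  have hval : ∫ x, ‖∑ m ∈ S, (herm2 m x : ℂ) * b m‖ ^ 2 = ∑ m ∈ S, ‖b m‖ ^ 2 := by
    apply Complex.ofReal_injective
    rw [← integral_complex_ofReal]
    simp_rw [key]
    rw [integral_finsetSum _ fun m _ => integrable_finsetSum _ fun n _ => hinteg m n]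
    rw [Complex.ofReal_sum]
    refine Finset.sum_congr rfl fun m hm => ?_
    rw [Complex.ofReal_pow]
    rw [integral_finsetSum _ fun n _ => hinteg m n, Finset.sum_eq_single m]
    · rw [integral_mul_const, integral_complex_ofReal, herm2_orthonormal, if_pos rfl, Complex.mul_conj']
      simp
    · intro n _ hn
      rw [integral_mul_const, integral_complex_ofReal, herm2_orthonormal, if_neg (Ne.symm hn)]
      simp
    · intro h; exact absurd hm h
  have hIr : Integrable (fun x => ‖∑ m ∈ S, (herm2 m x : ℂ) * b m‖ ^ 2) := by
    simpa only [RCLike.re_eq_complex_re, Complex.ofReal_re] using hI.re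
  have e : ∀ v : ℂ, ‖v‖ₑ ^ 2 = ENNReal.ofReal (‖v‖ ^ 2) := by
    intro v; rw [ENNReal.ofReal_pow (norm_nonneg _), ofReal_norm]
  simp_rw [e]
  rw [← ofReal_integral_eq_lintegral_ofReal hIr (by filter_upwards with x; positivity), hval, 
    ENNReal.ofReal_sum_of_nonneg (fun _ _ => by positivity)]

lemma coefH_cont {F : (ℝ × ℝ) × ℝ → ℂ} (hF : Dec3 F) (m : ℕ × ℕ) : Continuous (fun ζ => coefH m (fun x => FTz F x ζ)) := by
  obtain ⟨C, hC0, hC⟩ := FTz_bound hF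
  have h1 := FTz_cont hF
  have h2 := herm2_cont m
  obtain ⟨M1, hM1⟩ := hermiteFn_bounded m.1
  obtain ⟨M2, hM2⟩ := hermiteFn_bounded m.2
  have hM10 := (norm_nonneg _).trans (hM1 0)
  have hM20 := (norm_nonneg _).trans (hM2 0)
  unfold coefH
  apply continuous_of_dominated (bound := fun x : ℝ × ℝ => M1 * M2 * C * ((1 + x.1 ^ 2)⁻¹ * (1 + x.2 ^ 2)⁻¹))
  · intro ζ
    have : Continuous (fun x => FTz F x ζ) := h1.comp (by fun_prop : Continuous fun x : ℝ × ℝ => (x, ζ))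
    exact Continuous.aestronglyMeasurable (by fun_prop)
  · intro ζ
    filter_upwards with x
    rw [norm_mul]
    have a : ‖((herm2 m x : ℝ) : ℂ)‖ ≤ M1 * M2 := by
      rw [herm2]; push_cast; rw [norm_mul]; gcongr
      · exact hM1 _
      · exact hM2 _
    have b := hC x ζ
    rw [div_eq_mul_inv, mul_inv] at b
    rw [mul_assoc]
    gcongr
  · exact (integrable_inv1.mul_prod integrable_inv1).const_mul _
  · filter_upwards with x
    have : Continuous (fun ζ => FTz F x ζ) := h1.comp (by fun_prop : Continuous fun ζ : ℝ => (x, ζ))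
    fun_prop

/-- eigenvalues -/
def lam (m : ℕ × ℕ) : ℝ := (((m.1 : ℝ) + (m.2 : ℝ)) + 1) / 2

/-- symbol of `P_{≤N}` -/
def symb (φ : ℝ → ℝ) (N l ζ : ℝ) : ℝ := φ (ζ / N) * φ (l / N ^ 2)

lemma tsum_box {φ : ℝ → ℝ} (hφ0 : ∀ x : ℝ, 2 < |x| → φ x = 0) {N : ℝ} (hN : 0 < N) {M : ℕ} (hM : 4 * N ^ 2 ≤ M) (m : ℕ × ℕ) 
    (hm : m ∉ Finset.range M ×ˢ Finset.range M) : φ (lam m / N ^ 2) = 0 := by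
  apply hφ0
  have h0 : 0 ≤ lam m := by unfold lam; positivity
  rw [abs_of_nonneg (by positivity), lt_div_iff₀ (by positivity)]
  simp only [Finset.mem_product, Finset.mem_range, not_and_or, not_lt] at hm
  unfold lam
  rcases hm with h | h
  · have : (M : ℝ) ≤ m.1 := by exact_mod_cast h
    have := m.2.cast_nonneg (α := ℝ)
    linarith
  · have : (M : ℝ) ≤ m.2 := by exact_mod_cast h
    have := m.1.cast_nonneg (α := ℝ)
    linarith

lemma symb_dec {φ : ℝ → ℝ} (hφ : Continuous φ) (hφ0 : ∀ x : ℝ, 2 < |x| → φ x = 0) {N : ℝ} (hN : 0 < N) (l : ℝ)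
    {c : ℝ → ℂ} (hc : Continuous c) : Dec (fun ζ => (symb φ N l ζ : ℂ) * c ζ) := by
  apply dec_of_compact (R := 2 * N)
  · unfold symb; fun_prop
  · intro ζ hζ
    have : φ (ζ / N) = 0 := by
      apply hφ0
      rw [abs_div, abs_of_pos hN, lt_div_iff₀ hN]; exact hζ
    simp [symb, this]

lemma PleN_eq {φ : ℝ → ℝ} (hφ : Continuous φ) (hφ0 : ∀ x : ℝ, 2 < |x| → φ x = 0) {N : ℝ} (hN : 0 < N) {M : ℕ} (hM : 4 * N ^ 2 ≤ M)
    {F : (ℝ × ℝ) × ℝ → ℂ} (hF : Dec3 F) (p : (ℝ × ℝ) × ℝ) : PleN φ N F p = ((1 / (2 * Real.pi) : ℝ) : ℂ) * 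
      ∑ m ∈ Finset.range M ×ˢ Finset.range M, (herm2 m p.1 : ℂ) * ft (fun ζ => (symb φ N (lam m) ζ : ℂ) * coefH m (fun x => FTz F x ζ)) (-p.2) := by
  unfold PleN
  congr 1
  have e : ∀ ζ : ℝ, Complex.exp (Complex.I * p.2 * ζ) * ((φ (ζ / N) : ℝ) : ℂ) *
      ∑' m : ℕ × ℕ,
        ((φ ((((m.1 : ℝ) + (m.2 : ℝ)) + 1) / 2 / N ^ 2) : ℝ) : ℂ) *
          coefH m (fun x => FTz F x ζ) * ((herm2 m p.1 : ℝ) : ℂ) = 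
      ∑ m ∈ Finset.range M ×ˢ Finset.range M, (herm2 m p.1 : ℂ) * (cexp (-(I) * ζ * (-p.2 : ℝ)) * ((symb φ N (lam m) ζ : ℂ) * coefH m (fun x => FTz F x ζ))) := by
    intro ζ
    rw [tsum_eq_sum (s := Finset.range M ×ˢ Finset.range M), Finset.mul_sum]
    · refine Finset.sum_congr rfl fun m _ => ?_
      have : -(I) * ζ * ((-p.2 : ℝ) : ℂ) = Complex.I * p.2 * ζ := by push_cast; ring
      rw [this, symb, lam]
      push_cast; ring
    · intro m hm
      have := tsum_box hφ0 hN hM m hm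
      rw [lam] at this
      rw [this]; simp
  simp_rw [e]
  rw [integral_finsetSum]
  · refine Finset.sum_congr rfl fun m _ => ?_
    rw [integral_const_mul]; rfl
  · intro m _
    have hd := symb_dec hφ hφ0 hN (lam m) (coefH_cont hF m)
    apply Integrable.const_mul
    refine hd.integrable.norm.mono' (Continuous.aestronglyMeasurable ?_) ?_
    · have := hd.1; fun_prop
    · filter_upwards with ζ
      rw [norm_mul, norm_cexp_negI, one_mul]

lemma ft_sub {f g : ℝ → ℂ} (hf : Dec f) (hg : Dec g) (ξ : ℝ) : ft (fun x => f x - g x) ξ = ft f ξ - ft g ξ := by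
  have h : ∀ f, Dec f → Integrable (fun x : ℝ => cexp (-(I) * x * ξ) * f x) := by
    intro f hf
    have := hf.1
    refine hf.integrable.norm.mono' (Continuous.aestronglyMeasurable (by fun_prop)) ?_
    filter_upwards with ζ
    rw [norm_mul, norm_cexp_negI, one_mul]
  unfold ft
  rw [← integral_sub (h f hf) (h g hg)]
  simp_rw [mul_sub]

/-- symbol of `P_N` -/
def symbD (φ : ℝ → ℝ) (N l ζ : ℝ) : ℝ := symb φ N l ζ - symb φ (N / 2) l ζ

lemma PLP_norm {φ : ℝ → ℝ} (hφ : Continuous φ) (hφ0 : ∀ x : ℝ, 2 < |x| → φ x = 0) {N : ℝ} (hN : 0 < N)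
    {F : (ℝ × ℝ) × ℝ → ℂ} (hF : Dec3 F) : 
    ENNReal.ofReal (2 * Real.pi) * eLpNorm (PLP φ N F) 2 volume ^ 2 = 
      ∑' m : ℕ × ℕ, ∫⁻ ζ, ENNReal.ofReal (symbD φ N (lam m) ζ ^ 2) * ‖coefH m (fun x => FTz F x ζ)‖ₑ ^ 2 := by
  obtain ⟨M, hM⟩ := exists_nat_ge (4 * N ^ 2)
  have hN2 : 0 < N / 2 := by positivity
  have hM2 : 4 * (N / 2) ^ 2 ≤ M := by nlinarith [sq_nonneg N]
  set S := Finset.range M ×ˢ Finset.range M with hS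
  set a : ℕ × ℕ → ℝ → ℂ := fun m ζ => (symbD φ N (lam m) ζ : ℂ) * coefH m (fun x => FTz F x ζ) with ha
  have ea : ∀ m, a m = fun ζ => (symb φ N (lam m) ζ : ℂ) * coefH m (fun x => FTz F x ζ) - (symb φ (N / 2) (lam m) ζ : ℂ) * coefH m (fun x => FTz F x ζ) := by
    intro m; ext ζ; simp only [ha, symbD]; push_cast; ring
  have had : ∀ m, Dec (a m) := by
    intro m
    apply dec_of_compact (R := 2 * N)
    · have := coefH_cont hF m
      simp only [ha, symbD, symb]; fun_prop
    · intro ζ hζ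
      have h1 : φ (ζ / N) = 0 := by
        apply hφ0
        rw [abs_div, abs_of_pos hN, lt_div_iff₀ hN]; exact hζ
      have h2 : φ (ζ / (N / 2)) = 0 := by
        apply hφ0
        rw [abs_div, abs_of_pos hN2, lt_div_iff₀ hN2]; linarith
      simp [ha, symbD, symb, h1, h2]
  have hP : ∀ p, PLP φ N F p = ((1 / (2 * Real.pi) : ℝ) : ℂ) * ∑ m ∈ S, (herm2 m p.1 : ℂ) * ft (a m) (-p.2) := by
    intro p
    rw [PLP, PleN_eq hφ hφ0 hN hM hF, PleN_eq hφ hφ0 hN2 hM2 hF, ← mul_sub, ← Finset.sum_sub_distrib]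
    congr 1
    refine Finset.sum_congr rfl fun m _ => ?_
    rw [ea, ft_sub (symb_dec hφ hφ0 hN (lam m) (coefH_cont hF m)) (symb_dec hφ hφ0 hN2 (lam m) (coefH_cont hF m)), mul_sub]
  have hPc : Continuous (PLP φ N F) := by
    have : PLP φ N F = fun p => ((1 / (2 * Real.pi) : ℝ) : ℂ) * ∑ m ∈ S, (herm2 m p.1 : ℂ) * ft (a m) (-p.2) := funext hP
    rw [this]
    have h1 : ∀ m, Continuous (ft (a m)) := fun m => ft_measurable (had m)
    have h2 := herm2_cont
    fun_prop
  have hPm := hPc.measurable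
  rw [eLpNorm_two_sq, Measure.volume_eq_prod, lintegral_prod_symm _ (by fun_prop)]
  have step : ∀ z, ∫⁻ x, ‖PLP φ N F (x, z)‖ₑ ^ 2 = ENNReal.ofReal ((1 / (2 * Real.pi)) ^ 2) * ∑ m ∈ S, ‖ft (a m) (-z)‖ₑ ^ 2 := by
    intro z
    simp_rw [hP, enorm_mul, mul_pow]
    rw [lintegral_const_mul' _ _ (by finiteness), herm2_sum_norm]
    congr 1
    rw [← ofReal_norm, Complex.norm_real, Real.norm_of_nonneg (by positivity), ENNReal.ofReal_pow (by positivity)]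
  simp_rw [step]
  have hftm : ∀ m, Measurable (ft (a m)) := fun m => (ft_measurable (had m)).measurable
  rw [lintegral_const_mul' _ _ ENNReal.ofReal_ne_top, lintegral_finsetSum _ (fun m _ => by have := hftm m; fun_prop)]
  have step2 : ∀ m, ∫⁻ z, ‖ft (a m) (-z)‖ₑ ^ 2 = ENNReal.ofReal (2 * Real.pi) * ∫⁻ ζ, ENNReal.ofReal (symbD φ N (lam m) ζ ^ 2) * ‖coefH m (fun x => FTz F x ζ)‖ₑ ^ 2 := by
    intro m
    rw [lintegral_neg_eq_self (fun z => ‖ft (a m) z‖ₑ ^ 2), plancherel (had m)]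
    congr 1
    apply lintegral_congr; intro ζ
    simp only [ha]
    rw [enorm_mul, mul_pow, ← ofReal_norm, Complex.norm_real, ← ENNReal.ofReal_pow (norm_nonneg _), Real.norm_eq_abs, sq_abs]
  simp_rw [step2]
  rw [← Finset.mul_sum, tsum_eq_sum (s := S)]
  · rw [← mul_assoc, ← mul_assoc, ← ENNReal.ofReal_mul (by positivity), ← ENNReal.ofReal_mul (by positivity)]
    have : 2 * Real.pi * (1 / (2 * Real.pi)) ^ 2 * (2 * Real.pi) = 1 := by
      have := Real.pi_pos; field_simp
    rw [this, ENNReal.ofReal_one, one_mul]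
  · intro m hm
    have h1 := tsum_box hφ0 hN hM m hm
    have h2 := tsum_box hφ0 hN2 hM2 m hm
    simp [symbD, symb, h1, h2]

end

section

lemma phi_bound {φ : ℝ → ℝ} (hφ : Continuous φ) (hφ0 : ∀ x : ℝ, 2 < |x| → φ x = 0) : ∃ B : ℝ, 0 ≤ B ∧ ∀ x, |φ x| ≤ B := by
  obtain ⟨C, hC⟩ := (isCompact_Icc (a := (-2 : ℝ)) (b := 2)).exists_bound_of_continuousOn (f := φ) (by fun_prop)
  refine ⟨|C|, abs_nonneg _, fun x => ?_⟩
  by_cases hx : 2 < |x|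
  · rw [hφ0 x hx]; simp
  · exact (hC x (abs_le.1 (not_lt.1 hx))).trans (le_abs_self C)

lemma phi_two {φ : ℝ → ℝ} (hφ : Continuous φ) (hφ0 : ∀ x : ℝ, 2 < |x| → φ x = 0) {x : ℝ} (hx : 2 ≤ x) : φ x = 0 := by
  have h : Set.Ici (2 : ℝ) ⊆ {x | φ x = 0} := by
    rw [← closure_Ioi]
    apply closure_minimal
    · intro y hy
      exact hφ0 y (lt_of_lt_of_le hy (le_abs_self y))
    · exact isClosed_eq hφ continuous_const
  exact h hx

lemma symbD_supp {φ : ℝ → ℝ} 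
    (hφ1 : ∀ x : ℝ, |x| ≤ 1 → φ x = 1) (hφ0 : ∀ x : ℝ, 2 < |x| → φ x = 0) {N l ζ : ℝ} (hN : 0 < N) (hl : 0 ≤ l)
    (h : symbD φ N l ζ ≠ 0) : l + ζ ^ 2 ≤ 6 * N ^ 2 ∧ N ^ 2 < 4 * (l + ζ ^ 2) := by
  have hN2 : 0 < N / 2 := by positivity
  have hNs : 0 < N ^ 2 := by positivity
  constructor
  · by_contra! hc
    apply h
    have hor : 2 * N ^ 2 < l ∨ 2 * N < |ζ| := by
      by_contra! hh
      have : ζ ^ 2 ≤ (2 * N) ^ 2 := by rw [← sq_abs]; exact pow_le_pow_left₀ (abs_nonneg _) hh.2 2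
      nlinarith [hh.1]
    rcases hor with h1 | h1
    · have a1 : φ (l / N ^ 2) = 0 := hφ0 _ (by
        rw [abs_of_nonneg (by positivity), lt_div_iff₀ hNs]; exact h1)
      have a2 : φ (l / (N / 2) ^ 2) = 0 := hφ0 _ (by
        rw [abs_of_nonneg (by positivity), lt_div_iff₀ (by positivity)]; nlinarith)
      simp [symbD, symb, a1, a2]
    · have a1 : φ (ζ / N) = 0 := hφ0 _ (by
        rw [abs_div, abs_of_pos hN, lt_div_iff₀ hN]; exact h1)
      have a2 : φ (ζ / (N / 2)) = 0 := hφ0 _ (by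
        rw [abs_div, abs_of_pos hN2, lt_div_iff₀ hN2]; linarith)
      simp [symbD, symb, a1, a2]
  · by_contra! hc
    apply h
    have b1 : l ≤ (N / 2) ^ 2 := by nlinarith [sq_nonneg ζ]
    have b2 : |ζ| ≤ N / 2 := by
      apply abs_le_of_sq_le_sq _ hN2.le
      nlinarith
    have a1 : φ (l / N ^ 2) = 1 := hφ1 _ (by
        rw [abs_of_nonneg (by positivity), div_le_one hNs]; nlinarith)
    have a2 : φ (l / (N / 2) ^ 2) = 1 := hφ1 _ (by
        rw [abs_of_nonneg (by positivity), div_le_one (by positivity)]; exact b1)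
    have a3 : φ (ζ / N) = 1 := hφ1 _ (by
        rw [abs_div, abs_of_pos hN, div_le_one hN]; linarith)
    have a4 : φ (ζ / (N / 2)) = 1 := hφ1 _ (by
        rw [abs_div, abs_of_pos hN2, div_le_one hN2]; exact b2)
    simp [symbD, symb, a1, a2, a3, a4]

/-- the square-function symbol -/
def WW (s : ℝ) (φ : ℝ → ℝ) (l ζ : ℝ) : ℝ≥0∞ := 
  ∑' k : ℕ, ENNReal.ofReal ((2 : ℝ) ^ (2 * s * (k : ℝ))) * ENNReal.ofReal (symbD φ ((2 : ℝ) ^ k) l ζ ^ 2)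

lemma two_rpow (s : ℝ) (k : ℕ) : (2 : ℝ) ^ (2 * s * (k : ℝ)) = (((2 : ℝ) ^ k) ^ 2) ^ s := by
  rw [← pow_mul, ← Real.rpow_natCast, ← Real.rpow_mul (by norm_num)]
  congr 1; push_cast; ring

/-- Location of the dyadic scales that see a given frequency. -/
lemma exists_k0 {φ : ℝ → ℝ} 
    (hφ1 : ∀ x : ℝ, |x| ≤ 1 → φ x = 1) (hφ0 : ∀ x : ℝ, 2 < |x| → φ x = 0) {l ζ : ℝ} (hl : 1 / 2 ≤ l) : 
    ∃ k0 : ℕ, (∀ k, k ∉ Finset.Ico k0 (k0 + 3) → symbD φ ((2 : ℝ) ^ k) l ζ = 0) ∧ 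
      (∀ k ∈ Finset.Ico k0 (k0 + 3), l + ζ ^ 2 ≤ 6 * ((2 : ℝ) ^ k) ^ 2) := by
  have hρ : 0 < l + ζ ^ 2 := by positivity
  have hex : ∃ k : ℕ, l + ζ ^ 2 ≤ 6 * ((2 : ℝ) ^ k) ^ 2 := by
    obtain ⟨k, hk⟩ := pow_unbounded_of_one_lt (l + ζ ^ 2) (by norm_num : (1 : ℝ) < 2)
    refine ⟨k, ?_⟩
    have : (1 : ℝ) ≤ 2 ^ k := one_le_pow₀ (by norm_num)
    nlinarith
  classical
  refine ⟨Nat.find hex, fun k hk => ?_, fun k hk => ?_⟩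
  · by_contra hne
    obtain ⟨h1, h2⟩ := symbD_supp hφ1 hφ0 (by positivity) (by linarith) hne
    have h3 : Nat.find hex ≤ k := Nat.find_min' hex h1
    have h4 : Nat.find hex + 3 ≤ k := by
      by_contra! hh
      exact hk (Finset.mem_Ico.2 ⟨h3, hh⟩)
    have h5 := Nat.find_spec hex
    have h6 : (2 : ℝ) ^ (Nat.find hex) * 8 ≤ 2 ^ k := by
      calc _ = (2 : ℝ) ^ (Nat.find hex + 3) := by rw [pow_add]; norm_num
        _ ≤ _ := pow_le_pow_right₀ (by norm_num) h4
    have h7 : ((2 : ℝ) ^ (Nat.find hex) * 8) ^ 2 ≤ (2 ^ k) ^ 2 := pow_le_pow_left₀ (by positivity) h6 2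
    nlinarith
  · have h5 := Nat.find_spec hex
    have : (2 : ℝ) ^ (Nat.find hex) ≤ 2 ^ k := pow_le_pow_right₀ (by norm_num) (Finset.mem_Ico.1 hk).1
    refine h5.trans ?_
    gcongr

lemma WW_eq {φ : ℝ → ℝ} (s : ℝ) {l ζ : ℝ} {k0 : ℕ} (h : ∀ k, k ∉ Finset.Ico k0 (k0 + 3) → symbD φ ((2 : ℝ) ^ k) l ζ = 0) :
    WW s φ l ζ = ∑ k ∈ Finset.Ico k0 (k0 + 3), ENNReal.ofReal ((((2 : ℝ) ^ k) ^ 2) ^ s * symbD φ ((2 : ℝ) ^ k) l ζ ^ 2) := by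
  unfold WW
  rw [tsum_eq_sum (s := Finset.Ico k0 (k0 + 3))]
  · refine Finset.sum_congr rfl fun k _ => ?_
    rw [two_rpow, ENNReal.ofReal_mul (by positivity)]
  · intro k hk
    rw [h k hk]; simp

lemma WW_le {φ : ℝ → ℝ} (hφ : Continuous φ)
    (hφ1 : ∀ x : ℝ, |x| ≤ 1 → φ x = 1) (hφ0 : ∀ x : ℝ, 2 < |x| → φ x = 0) {s : ℝ} (hs : 0 ≤ s) : 
    ∃ K : ℝ≥0, ∀ l ζ : ℝ, 1 / 2 ≤ l → WW s φ l ζ ≤ K * ENNReal.ofReal ((l + ζ ^ 2) ^ s) := by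
  obtain ⟨B, hB0, hB⟩ := phi_bound hφ hφ0
  refine ⟨(3 * (4 ^ s * (2 * B ^ 2) ^ 2)).toNNReal, fun l ζ hl => ?_⟩
  obtain ⟨k0, h1, h2⟩ := exists_k0 hφ1 hφ0 (ζ := ζ) hl
  have hρ : 0 < l + ζ ^ 2 := by positivity
  rw [WW_eq s h1]
  change _ ≤ ENNReal.ofReal _ * _
  rw [← ENNReal.ofReal_mul (by positivity), ← ENNReal.ofReal_sum_of_nonneg (fun _ _ => by positivity)]
  apply ENNReal.ofReal_le_ofReal
  have key : ∀ k ∈ Finset.Ico k0 (k0 + 3), (((2 : ℝ) ^ k) ^ 2) ^ s * symbD φ ((2 : ℝ) ^ k) l ζ ^ 2 ≤ 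
      4 ^ s * (2 * B ^ 2) ^ 2 * (l + ζ ^ 2) ^ s := by
    intro k _
    by_cases hne : symbD φ ((2 : ℝ) ^ k) l ζ = 0
    · rw [hne]; simp; positivity
    obtain ⟨_, h4⟩ := symbD_supp hφ1 hφ0 (by positivity) (by linarith) hne
    have h5 : (((2 : ℝ) ^ k) ^ 2) ^ s ≤ 4 ^ s * (l + ζ ^ 2) ^ s := by
      rw [← Real.mul_rpow (by norm_num) hρ.le]
      exact Real.rpow_le_rpow (by positivity) h4.le hs
    have hsy : ∀ N, |symb φ N l ζ| ≤ B ^ 2 := by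
      intro N
      rw [symb, abs_mul, sq B]
      exact mul_le_mul (hB _) (hB _) (abs_nonneg _) hB0
    have h6 : symbD φ ((2 : ℝ) ^ k) l ζ ^ 2 ≤ (2 * B ^ 2) ^ 2 := by
      rw [← sq_abs]
      apply pow_le_pow_left₀ (abs_nonneg _)
      rw [symbD]
      refine (abs_sub _ _).trans ?_
      linarith [hsy (2 ^ k), hsy (2 ^ k / 2)]
    calc _ ≤ (4 ^ s * (l + ζ ^ 2) ^ s) * (2 * B ^ 2) ^ 2 := by gcongr
      _ = _ := by ring
  refine (Finset.sum_le_sum key).trans (le_of_eq ?_)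
  simp; ring

lemma le_WW {φ : ℝ → ℝ} (hφ : Continuous φ)
    (hφ1 : ∀ x : ℝ, |x| ≤ 1 → φ x = 1) (hφ0 : ∀ x : ℝ, 2 < |x| → φ x = 0) {s : ℝ} (hs : 0 ≤ s) : 
    ∃ K : ℝ≥0, ∀ l ζ : ℝ, 1 / 2 ≤ l → ENNReal.ofReal ((l + ζ ^ 2) ^ s) ≤ K * WW s φ l ζ := by
  refine ⟨(3 * 6 ^ s : ℝ).toNNReal, fun l ζ hl => ?_⟩
  obtain ⟨k0, h1, h2⟩ := exists_k0 hφ1 hφ0 (ζ := ζ) hl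
  have hρ : 0 < l + ζ ^ 2 := by positivity
  rw [WW_eq s h1]
  change _ ≤ ENNReal.ofReal _ * _
  rw [← ENNReal.ofReal_sum_of_nonneg (fun _ _ => by positivity), ← ENNReal.ofReal_mul (by positivity)]
  apply ENNReal.ofReal_le_ofReal
  have hsum : ∑ k ∈ Finset.Ico k0 (k0 + 3), symbD φ ((2 : ℝ) ^ k) l ζ = 1 := by
    obtain ⟨n1, hn1⟩ := pow_unbounded_of_one_lt (l + |ζ|) (by norm_num : (1 : ℝ) < 2)
    set n := n1 + k0 + 3 with hn
    have e1 : ∑ k ∈ Finset.Ico k0 (k0 + 3), symbD φ ((2 : ℝ) ^ k) l ζ = ∑ k ∈ Finset.range n, symbD φ ((2 : ℝ) ^ k) l ζ := by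
      apply Finset.sum_subset
      · intro k hk
        rw [Finset.mem_Ico] at hk
        rw [Finset.mem_range]; omega
      · intro k _ hk
        exact h1 k hk
    have e2 : ∀ k : ℕ, symbD φ ((2 : ℝ) ^ k) l ζ = symb φ ((2 : ℝ) ^ (k + 1) / 2) l ζ - symb φ ((2 : ℝ) ^ k / 2) l ζ := by
      intro k
      rw [symbD, pow_succ, mul_div_cancel_right₀ _ (by norm_num)]
    rw [e1]
    simp_rw [e2]
    rw [Finset.sum_range_sub (fun k => symb φ ((2 : ℝ) ^ k / 2) l ζ)]
    have e3 : symb φ ((2 : ℝ) ^ 0 / 2) l ζ = 0 := by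
      rw [symb, phi_two hφ hφ0 (x := l / ((2 : ℝ) ^ 0 / 2) ^ 2)]
      · simp
      · norm_num; linarith
    have hbig : l + |ζ| < (2 : ℝ) ^ n / 2 := by
      have : (2 : ℝ) ^ n = 2 ^ n1 * 2 ^ (k0 + 2) * 2 := by rw [hn, ← pow_add, ← pow_succ]; congr 1
      rw [this, mul_div_cancel_right₀ _ (by norm_num)]
      have : (1 : ℝ) ≤ 2 ^ (k0 + 2) := one_le_pow₀ (by norm_num)
      exact lt_of_lt_of_le hn1 (le_mul_of_one_le_right (by positivity) this)
    have hone : (1 : ℝ) ≤ 2 ^ n / 2 := by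
      have : (2 : ℝ) ^ 1 ≤ 2 ^ n := pow_le_pow_right₀ (by norm_num) (by omega)
      linarith
    have e4 : symb φ ((2 : ℝ) ^ n / 2) l ζ = 1 := by
      have hz := abs_nonneg ζ
      rw [symb, hφ1, hφ1, mul_one]
      · rw [abs_of_nonneg (by positivity), div_le_one (by positivity)]
        nlinarith
      · rw [abs_div, abs_of_pos (by positivity : (0 : ℝ) < 2 ^ n / 2), div_le_one (by positivity)]
        linarith
    rw [e3, e4, sub_zero]
  have hcs := sq_sum_le_card_mul_sum_sq (s := Finset.Ico k0 (k0 + 3)) (f := fun k => symbD φ ((2 : ℝ) ^ k) l ζ)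
  rw [hsum] at hcs
  simp only [Nat.card_Ico, add_tsub_cancel_left, Nat.cast_ofNat, one_pow] at hcs
  calc (l + ζ ^ 2) ^ s ≤ (l + ζ ^ 2) ^ s * (3 * ∑ k ∈ Finset.Ico k0 (k0 + 3), symbD φ ((2 : ℝ) ^ k) l ζ ^ 2) := 
        le_mul_of_one_le_right (by positivity) hcs
    _ = 3 * ∑ k ∈ Finset.Ico k0 (k0 + 3), (l + ζ ^ 2) ^ s * symbD φ ((2 : ℝ) ^ k) l ζ ^ 2 := by
        rw [← Finset.mul_sum]; ring
    _ ≤ 3 * ∑ k ∈ Finset.Ico k0 (k0 + 3), (6 ^ s * (((2 : ℝ) ^ k) ^ 2) ^ s) * symbD φ ((2 : ℝ) ^ k) l ζ ^ 2 := by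
        gcongr with k hk
        rw [← Real.mul_rpow (by norm_num) (by positivity)]
        exact Real.rpow_le_rpow hρ.le (h2 k hk) hs
    _ = _ := by
        simp_rw [mul_assoc, ← Finset.mul_sum]

lemma lam_ge (m : ℕ × ℕ) : 1 / 2 ≤ lam m := by
  unfold lam
  have := m.1.cast_nonneg (α := ℝ)
  have := m.2.cast_nonneg (α := ℝ)
  linarith

lemma symbD_cont {φ : ℝ → ℝ} (hφ : Continuous φ) (N l : ℝ) : Continuous (fun ζ => symbD φ N l ζ) := by
  unfold symbD symb; fun_prop

lemma Sig_sq {φ : ℝ → ℝ} (hφ : Continuous φ) (hφ0 : ∀ x : ℝ, 2 < |x| → φ x = 0) (s : ℝ)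
    {F : (ℝ × ℝ) × ℝ → ℂ} (hF : Dec3 F) : ENNReal.ofReal (2 * Real.pi) * Sig0Norm s φ F ^ 2 = 
      ∑' m : ℕ × ℕ, ∫⁻ ζ, WW s φ (lam m) ζ * ‖coefH m (fun x => FTz F x ζ)‖ₑ ^ 2 := by
  unfold Sig0Norm
  rw [half_sq, ← ENNReal.tsum_mul_left]
  have e : ∀ k : ℕ, ENNReal.ofReal (2 * Real.pi) * (ENNReal.ofReal ((2 : ℝ) ^ (2 * s * (k : ℝ))) *
      (eLpNorm (PLP φ ((2 : ℝ) ^ (k : ℕ)) F) 2 volume) ^ 2) = ∑' m : ℕ × ℕ, ENNReal.ofReal ((2 : ℝ) ^ (2 * s * (k : ℝ))) * ∫⁻ ζ, ENNReal.ofReal (symbD φ ((2 : ℝ) ^ k) (lam m) ζ ^ 2) * ‖coefH m (fun x => FTz F x ζ)‖ₑ ^ 2 := by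
    intro k
    rw [mul_left_comm, PLP_norm hφ hφ0 (by positivity) hF, ENNReal.tsum_mul_left]
  simp_rw [e]
  rw [ENNReal.tsum_comm]
  congr 1; ext m
  have hc := (coefH_cont hF m).measurable
  have hd : ∀ N, Measurable (fun ζ => symbD φ N (lam m) ζ) := fun N => (symbD_cont hφ N (lam m)).measurable
  unfold WW
  simp_rw [← ENNReal.tsum_mul_right]
  rw [lintegral_tsum]
  · congr 1; ext k
    rw [← lintegral_const_mul' _ _ ENNReal.ofReal_ne_top]
    simp only [mul_assoc]
  · intro k
    have := hd (2 ^ k)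
    exact (((this.pow_const 2).ennreal_ofReal.const_mul _).mul (hc.enorm.pow_const 2)).aemeasurable

lemma TT_eq (s : ℝ) {F : (ℝ × ℝ) × ℝ → ℂ} (hF : Dec3 F) : TT s F = 
    ∑' m : ℕ × ℕ, ∫⁻ ζ, ENNReal.ofReal ((lam m + ζ ^ 2) ^ s) * ‖coefH m (fun x => FTz F x ζ)‖ₑ ^ 2 := by
  unfold TT RR lam
  rw [lintegral_tsum]
  intro m
  have hc := (coefH_cont hF m).measurable
  have h2 : Measurable (fun ζ : ℝ => (((m.1 : ℝ) + m.2 + 1) / 2 + ζ ^ 2) ^ s) := by fun_prop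
  exact (h2.ennreal_ofReal.mul (hc.enorm.pow_const 2)).aemeasurable

lemma half_mono {A B : ℝ≥0∞} {K : ℝ≥0} {C : ℝ} (hC : Real.sqrt K ≤ C) (h : A ≤ K * B) : 
    A ^ ((1 : ℝ) / 2) ≤ ENNReal.ofReal C * B ^ ((1 : ℝ) / 2) := by
  calc A ^ ((1 : ℝ) / 2) ≤ (K * B) ^ ((1 : ℝ) / 2) := ENNReal.rpow_le_rpow h (by norm_num)
    _ = (K : ℝ≥0∞) ^ ((1 : ℝ) / 2) * B ^ ((1 : ℝ) / 2) := ENNReal.mul_rpow_of_nonneg _ _ (by norm_num)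
    _ ≤ _ := by
      gcongr
      rw [← ENNReal.ofReal_coe_nnreal, ENNReal.ofReal_rpow_of_nonneg (NNReal.coe_nonneg K) (by norm_num), ← Real.sqrt_eq_rpow]
      exact ENNReal.ofReal_le_ofReal hC

lemma sq_half (x : ℝ≥0∞) : (x ^ 2) ^ ((1 : ℝ) / 2) = x := by
  rw [← ENNReal.rpow_natCast, ← ENNReal.rpow_mul]; norm_num

theorem main'
    (φ : ℝ → ℝ) (hφ : ContDiff ℝ (⊤ : ℕ∞) φ)
    (hφ1 : ∀ x : ℝ, |x| ≤ 1 → φ x = 1) (hφ0 : ∀ x : ℝ, 2 < |x| → φ x = 0)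
    (s : ℝ) (hs : 0 ≤ s) :
    ∃ C : ℝ, 0 < C ∧ ∀ F : SchwartzMap ((ℝ × ℝ) × ℝ) ℂ,
      Sig0Norm s φ (fun p => F p) ≤
          ENNReal.ofReal C *
            ((SobNorm s (fun p => F p)) ^ 2 + (WtNorm s (fun p => F p)) ^ 2) ^ ((1 : ℝ) / 2) ∧
      ((SobNorm s (fun p => F p)) ^ 2 + (WtNorm s (fun p => F p)) ^ 2) ^ ((1 : ℝ) / 2) ≤
          ENNReal.ofReal C * Sig0Norm s φ (fun p => F p) := by
  have hφc := hφ.continuous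
  obtain ⟨K1, h1⟩ := TT_le hs
  obtain ⟨K2, h2⟩ := le_TT hs
  obtain ⟨K3, h3⟩ := WW_le hφc hφ1 hφ0 hs
  obtain ⟨K4, h4⟩ := le_WW hφc hφ1 hφ0 hs
  set c : ℝ≥0 := (2 * Real.pi).toNNReal with hc
  have hpi : 1 ≤ ENNReal.ofReal (2 * Real.pi) := by
    rw [← ENNReal.ofReal_one]; apply ENNReal.ofReal_le_ofReal; linarith [Real.pi_gt_three]
  refine ⟨Real.sqrt (K3 * K1 : ℝ≥0) + Real.sqrt (K2 * (K4 * c) : ℝ≥0) + 1, by positivity, fun F => ?_⟩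
  have hF := schwartz_dec3 F
  have u1 : Sig0Norm s φ (fun p => F p) ^ 2 ≤ ((K3 * K1 : ℝ≥0) : ℝ≥0∞) * ((SobNorm s (fun p => F p)) ^ 2 + (WtNorm s (fun p => F p)) ^ 2) := by
    calc _ ≤ ENNReal.ofReal (2 * Real.pi) * Sig0Norm s φ (fun p => F p) ^ 2 := le_mul_of_one_le_left (by positivity) hpi
      _ ≤ K3 * TT s (fun p => F p) := by
          rw [Sig_sq hφc hφ0 s hF, TT_eq s hF]
          apply tsum_le_const_mul; intro m
          apply lintegral_le_const_mul; intro ζ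
          rw [← mul_assoc]
          gcongr
          exact h3 _ _ (lam_ge m)
      _ ≤ _ := by
          push_cast
          rw [mul_assoc]
          gcongr
          exact h1 _ hF
  have u2 : (SobNorm s (fun p => F p)) ^ 2 + (WtNorm s (fun p => F p)) ^ 2 ≤ ((K2 * (K4 * c) : ℝ≥0) : ℝ≥0∞) * Sig0Norm s φ (fun p => F p) ^ 2 := by
    calc _ ≤ K2 * TT s (fun p => F p) := h2 _ hF
      _ ≤ K2 * (K4 * (ENNReal.ofReal (2 * Real.pi) * Sig0Norm s φ (fun p => F p) ^ 2)) := by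
          rw [Sig_sq hφc hφ0 s hF, TT_eq s hF]
          gcongr
          apply tsum_le_const_mul; intro m
          apply lintegral_le_const_mul; intro ζ
          rw [← mul_assoc]
          gcongr
          exact h4 _ _ (lam_ge m)
      _ = _ := by
          push_cast
          rw [mul_assoc, mul_assoc]; rfl
  constructor
  · have := half_mono (C := Real.sqrt (K3 * K1 : ℝ≥0) + Real.sqrt (K2 * (K4 * c) : ℝ≥0) + 1) 
      (by have := Real.sqrt_nonneg ((K2 * (K4 * c) : ℝ≥0) : ℝ); linarith) u1
    rwa [sq_half] at this
  · have := half_mono (C := Real.sqrt (K3 * K1 : ℝ≥0) + Real.sqrt (K2 * (K4 * c) : ℝ≥0) + 1) 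
      (by have := Real.sqrt_nonneg ((K3 * K1 : ℝ≥0) : ℝ); linarith) u2
    rwa [sq_half] at this

end

/-- Norm equivalence (Yajima): `‖F‖_{Σ₀^s} ≃ (‖F‖²_{H^s(ℝ³)} + ‖|x|^s F‖²_{L²})^{1/2}`
for Schwartz `F`. -/
theorem Sigma0_norm_equivalence
    (φ : ℝ → ℝ) (hφ : ContDiff ℝ (⊤ : ℕ∞) φ)
    (hφ1 : ∀ x : ℝ, |x| ≤ 1 → φ x = 1) (hφ0 : ∀ x : ℝ, 2 < |x| → φ x = 0)
    (s : ℝ) (hs : 0 ≤ s) :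
    ∃ C : ℝ, 0 < C ∧ ∀ F : SchwartzMap ((ℝ × ℝ) × ℝ) ℂ,
      Sig0Norm s φ (fun p => F p) ≤
          ENNReal.ofReal C *
            ((SobNorm s (fun p => F p)) ^ 2 + (WtNorm s (fun p => F p)) ^ 2) ^ ((1 : ℝ) / 2) ∧
      ((SobNorm s (fun p => F p)) ^ 2 + (WtNorm s (fun p => F p)) ^ 2) ^ ((1 : ℝ) / 2) ≤
          ENNReal.ofReal C * Sig0Norm s φ (fun p => F p) := by
  exact main' φ hφ hφ1 hφ0 s hs
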